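/- (Existence and uniqueness for the double obstacle problem on the flat torus.) Let φ₋, φ₊ : ℝ^d → ℝ be non-constant C², (2πℤ)^d-periodic functions with φ₊ − φ₋ ≥ τ everywhere, for some τ > 0. Then the double obstacle problem has a solution u which is continuously differentiable with α-Hölder continuous gradient for every α ∈ (0,1). If max φ₋ ≥ min φ₊, the solution is unique among continuous periodic solutions; in particular, when max φ₋ = min φ₊, the unique solution is the constant function u ≡ max φ₋. -/

import Mathlib

open MeasureTheory Real

noncomputable section

/-- Euclidean space `ℝ^d`. -/
abbrev Rd (d : ℕ) := EuclideanSpace ℝ (Fin d)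

/-- `f : ℝ^d → α` is `(2πℤ)^d`-periodic. -/
def PeriodicRd {d : ℕ} {α : Type*} (f : Rd d → α) : Prop :=
  ∀ (x : Rd d) (j : Fin d),
    f (x + (2 * Real.pi) • EuclideanSpace.single j (1 : ℝ)) = f x

/-- The Euclidean Laplacian `Δ = ∑ ∂²/∂xⱼ²`. -/
noncomputable def lapRd {d : ℕ} (f : Rd d → ℝ) (x : Rd d) : ℝ :=
  ∑ j : Fin d,
    fderiv ℝ (fun y => fderiv ℝ f y (EuclideanSpace.single j (1 : ℝ))) x
      (EuclideanSpace.single j (1 : ℝ))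

/-- The fundamental domain `E = [0,2π)^d`. -/
def EfdR (d : ℕ) : Set (Rd d) := {x | ∀ j : Fin d, x j ∈ Set.Ico 0 (2 * Real.pi)}

/-- `u` is a solution of the double obstacle problem with obstacles `φ₋ ≤ u ≤ φ₊`:
`u` is continuous, periodic, trapped between the obstacles, distributionally
subharmonic on `{u > φ₋}` and distributionally superharmonic on `{u < φ₊}`. -/
def IsDOPSolution {d : ℕ} (φm φp u : Rd d → ℝ) : Prop :=
  Continuous u ∧ PeriodicRd u ∧ (∀ x, φm x ≤ u x ∧ u x ≤ φp x) ∧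
    (∀ χ : Rd d → ℝ, ContDiff ℝ (⊤ : ℕ∞) χ → HasCompactSupport χ → (∀ x, 0 ≤ χ x) →
      tsupport χ ⊆ {x | φm x < u x} → 0 ≤ ∫ x : Rd d, u x * lapRd χ x) ∧
    (∀ χ : Rd d → ℝ, ContDiff ℝ (⊤ : ℕ∞) χ → HasCompactSupport χ → (∀ x, 0 ≤ χ x) →
      tsupport χ ⊆ {x | u x < φp x} → (∫ x : Rd d, u x * lapRd χ x) ≤ 0)

/-- The one-dimensional profile of the mollification kernel. -/
def bumpProfile (s : ℝ) : ℝ := expNegInvGlue (1 - s)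

theorem bumpProfile_nonneg (s : ℝ) : 0 ≤ bumpProfile s := expNegInvGlue.nonneg _

theorem bumpProfile_pos {s : ℝ} (hs : s < 1) : 0 < bumpProfile s :=
  expNegInvGlue.pos_of_pos (by linarith)

theorem bumpProfile_eq_zero {s : ℝ} (hs : 1 ≤ s) : bumpProfile s = 0 :=
  expNegInvGlue.zero_of_nonpos (by linarith)

theorem contDiff_bumpProfile : ContDiff ℝ (⊤ : ℕ∞) bumpProfile :=
  expNegInvGlue.contDiff.comp (contDiff_const.sub contDiff_id)

theorem continuous_bumpProfile : Continuous bumpProfile := contDiff_bumpProfile.continuous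

theorem contDiff_bumpProfile_norm_sq (d : ℕ) :
    ContDiff ℝ (⊤ : ℕ∞) (fun z : Rd d => bumpProfile (‖z‖ ^ 2)) :=
  contDiff_bumpProfile.comp (contDiff_norm_sq ℝ)

theorem hasCompactSupport_of_norm_gt_one {d : ℕ} {F : Type*} [Zero F] {f : Rd d → F}
    (hf : ∀ z, 1 < ‖z‖ → f z = 0) : HasCompactSupport f :=
  HasCompactSupport.intro (isCompact_closedBall 0 1) fun z hz => hf z (by simpa using hz)

theorem hasCompactSupport_bumpProfile_norm_sq (d : ℕ) :
    HasCompactSupport (fun z : Rd d => bumpProfile (‖z‖ ^ 2)) :=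
  hasCompactSupport_of_norm_gt_one fun z hz => bumpProfile_eq_zero (by nlinarith)

/-- The total mass of the unnormalised radial bump on `ℝ^d`. -/
def bumpMass (d : ℕ) : ℝ := ∫ z : Rd d, bumpProfile (‖z‖ ^ 2)

theorem bumpMass_pos (d : ℕ) : 0 < bumpMass d :=
  (contDiff_bumpProfile_norm_sq d).continuous.integral_pos_of_hasCompactSupport_nonneg_nonzero
    (hasCompactSupport_bumpProfile_norm_sq d) (fun _ => bumpProfile_nonneg _) (x := 0)
    (bumpProfile_pos (by simp)).ne'

/-- A smooth radial probability density supported in the closed unit ball. -/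
def radialKernel {d : ℕ} (z : Rd d) : ℝ := (bumpMass d)⁻¹ * bumpProfile (‖z‖ ^ 2)

theorem radialKernel_nonneg {d : ℕ} (z : Rd d) : 0 ≤ radialKernel z :=
  mul_nonneg (inv_nonneg.2 (bumpMass_pos d).le) (bumpProfile_nonneg _)

theorem radialKernel_pos {d : ℕ} {z : Rd d} (hz : ‖z‖ < 1) : 0 < radialKernel z :=
  mul_pos (inv_pos.2 (bumpMass_pos d)) (bumpProfile_pos (by nlinarith [norm_nonneg z]))

theorem radialKernel_eq_zero {d : ℕ} {z : Rd d} (hz : 1 ≤ ‖z‖) : radialKernel z = 0 := by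
  rw [radialKernel, bumpProfile_eq_zero (by nlinarith), mul_zero]

theorem radialKernel_neg {d : ℕ} (z : Rd d) : radialKernel (-z) = radialKernel z := by
  simp [radialKernel]

theorem contDiff_radialKernel (d : ℕ) : ContDiff ℝ (⊤ : ℕ∞) (radialKernel (d := d)) :=
  contDiff_const.mul (contDiff_bumpProfile_norm_sq d)

theorem continuous_radialKernel (d : ℕ) : Continuous (radialKernel (d := d)) :=
  (contDiff_radialKernel d).continuous

theorem hasCompactSupport_radialKernel (d : ℕ) : HasCompactSupport (radialKernel (d := d)) :=
  hasCompactSupport_of_norm_gt_one fun _ hz => radialKernel_eq_zero hz.le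

theorem integral_radialKernel (d : ℕ) : ∫ z : Rd d, radialKernel z = 1 := by
  simp only [radialKernel, integral_const_mul]
  exact inv_mul_cancel₀ (bumpMass_pos d).ne'

/-- A non-negative radial potential `θ` with `∇θ(z) = -ρ(z) z`, where `ρ` is `radialKernel`. -/
def kernelPotential {d : ℕ} (z : Rd d) : ℝ :=
  (2 * bumpMass d)⁻¹ * ∫ s in (‖z‖ ^ 2)..1, bumpProfile s

theorem kernelPotential_eq_zero {d : ℕ} {z : Rd d} (hz : 1 ≤ ‖z‖) : kernelPotential z = 0 := by
  have h1 : (1 : ℝ) ≤ ‖z‖ ^ 2 := by nlinarith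
  have : ∫ s in (‖z‖ ^ 2)..1, bumpProfile s = ∫ s in (‖z‖ ^ 2)..1, (0 : ℝ) := by
    refine intervalIntegral.integral_congr fun s hs => ?_
    rw [Set.uIcc_of_ge h1] at hs
    exact bumpProfile_eq_zero hs.1
  simp [kernelPotential, this]

theorem kernelPotential_nonneg {d : ℕ} (z : Rd d) : 0 ≤ kernelPotential z := by
  rcases le_or_gt 1 ‖z‖ with hz | hz
  · rw [kernelPotential_eq_zero hz]
  · refine mul_nonneg (inv_nonneg.2 (by linarith [bumpMass_pos d])) ?_
    exact intervalIntegral.integral_nonneg (by nlinarith [norm_nonneg z])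
      fun s _ => bumpProfile_nonneg s

theorem hasFDerivAt_kernelPotential {d : ℕ} (z : Rd d) :
    HasFDerivAt kernelPotential (-(radialKernel z • innerSL ℝ z)) z := by
  have h1 : HasDerivAt (fun t : ℝ => ∫ s in t..1, bumpProfile s) (-bumpProfile (‖z‖ ^ 2))
      (‖z‖ ^ 2) :=
    intervalIntegral.integral_hasDerivAt_left (continuous_bumpProfile.intervalIntegrable _ _)
      (continuous_bumpProfile.stronglyMeasurableAtFilter _ _) continuous_bumpProfile.continuousAt
  have h2 : HasFDerivAt (fun z : Rd d => ‖z‖ ^ 2) (2 • innerSL ℝ z) z :=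
    (hasStrictFDerivAt_norm_sq z).hasFDerivAt
  have h3 := (h1.comp_hasFDerivAt z h2).const_mul (2 * bumpMass d)⁻¹
  refine h3.congr_fderiv ?_
  ext v
  simp only [smul_apply, neg_apply, innerSL_apply_apply,
    smul_eq_mul, radialKernel, mul_inv]
  simp
  ring

theorem continuous_kernelPotential (d : ℕ) : Continuous (kernelPotential (d := d)) :=
  continuous_iff_continuousAt.2 fun z => (hasFDerivAt_kernelPotential z).continuousAt

theorem hasCompactSupport_kernelPotential (d : ℕ) :
    HasCompactSupport (kernelPotential (d := d)) :=
  hasCompactSupport_of_norm_gt_one fun _ hz => kernelPotential_eq_zero hz.le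

/-- The mass of `kernelPotential`. -/
def potentialMass (d : ℕ) : ℝ := ∫ z : Rd d, kernelPotential z

theorem potentialMass_pos (d : ℕ) : 0 < potentialMass d := by
  refine (continuous_kernelPotential d).integral_pos_of_hasCompactSupport_nonneg_nonzero
    (hasCompactSupport_kernelPotential d) kernelPotential_nonneg (x := 0) (ne_of_gt ?_)
  refine mul_pos (inv_pos.2 (by linarith [bumpMass_pos d])) ?_
  exact intervalIntegral.intervalIntegral_pos_of_pos_on
    (continuous_bumpProfile.intervalIntegrable _ _) (fun s hs => bumpProfile_pos hs.2) (by simp)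

theorem integrable_radialKernel_mul {d : ℕ} {g : Rd d → ℝ} (hg : Continuous g) :
    Integrable (fun z => radialKernel z * g z) :=
  ((continuous_radialKernel d).mul hg).integrable_of_hasCompactSupport
    (hasCompactSupport_radialKernel d).mul_right

/-- The average of `u` around `x` at scale `h`, weighted by `radialKernel`. -/
def mollify {d : ℕ} (h : ℝ) (u : Rd d → ℝ) (x : Rd d) : ℝ :=
  ∫ z : Rd d, radialKernel z * u (x - h • z)

theorem mollify_const {d : ℕ} (h c : ℝ) (x : Rd d) : mollify h (fun _ => c) x = c := by
  simp [mollify, integral_mul_const, integral_radialKernel]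

theorem integrable_mollify_integrand {d : ℕ} {u : Rd d → ℝ} (hu : Continuous u) (h : ℝ)
    (x : Rd d) : Integrable (fun z => radialKernel z * u (x - h • z)) :=
  integrable_radialKernel_mul (by fun_prop)

theorem mollify_mono {d : ℕ} {u v : Rd d → ℝ} (hu : Continuous u) (hv : Continuous v) {h : ℝ}
    {x : Rd d} (huv : ∀ y ∈ Metric.closedBall x |h|, u y ≤ v y) :
    mollify h u x ≤ mollify h v x := by
  refine integral_mono (integrable_mollify_integrand hu h x)
    (integrable_mollify_integrand hv h x) fun z => ?_
  rcases le_or_gt 1 ‖z‖ with hz | hz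
  · simp [radialKernel_eq_zero hz]
  · refine mul_le_mul_of_nonneg_left (huv _ ?_) (radialKernel_nonneg z)
    simpa [norm_smul] using mul_le_of_le_one_right (abs_nonneg h) hz.le

theorem mollify_le {d : ℕ} {u : Rd d → ℝ} (hu : Continuous u) {h c : ℝ} {x : Rd d}
    (huc : ∀ y ∈ Metric.closedBall x |h|, u y ≤ c) : mollify h u x ≤ c :=
  (mollify_mono hu continuous_const huc).trans_eq (mollify_const h c x)

theorem le_mollify {d : ℕ} {u : Rd d → ℝ} (hu : Continuous u) {h c : ℝ} {x : Rd d}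
    (huc : ∀ y ∈ Metric.closedBall x |h|, c ≤ u y) : c ≤ mollify h u x :=
  (mollify_const h c x).symm.trans_le (mollify_mono continuous_const hu huc)

theorem abs_mollify_le {d : ℕ} {u : Rd d → ℝ} (hu : Continuous u) {h c : ℝ} {x : Rd d}
    (huc : ∀ y ∈ Metric.closedBall x |h|, |u y| ≤ c) : |mollify h u x| ≤ c :=
  abs_le.2 ⟨le_mollify hu fun y hy => (abs_le.1 (huc y hy)).1,
    mollify_le hu fun y hy => (abs_le.1 (huc y hy)).2⟩

theorem mollify_sub {d : ℕ} {u v : Rd d → ℝ} (hu : Continuous u) (hv : Continuous v) (h : ℝ)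
    (x : Rd d) : mollify h (fun y => u y - v y) x = mollify h u x - mollify h v x := by
  simp only [mollify, mul_sub]
  exact integral_sub (integrable_mollify_integrand hu h x) (integrable_mollify_integrand hv h x)

theorem mollify_const_mul {d : ℕ} (u : Rd d → ℝ) (c h : ℝ) (x : Rd d) :
    mollify h (fun y => c * u y) x = c * mollify h u x := by
  simp only [mollify, mul_left_comm _ c, integral_const_mul]

theorem mollify_comp_add {d : ℕ} (u : Rd d → ℝ) (h : ℝ) (e x : Rd d) :
    mollify h (fun y => u (y + e)) x = mollify h u (x + e) := by
  simp only [mollify, sub_add_eq_add_sub]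

theorem continuous_mollify {d : ℕ} {u : Rd d → ℝ} (hu : Continuous u) (h : ℝ) :
    Continuous (mollify h u) := by
  have h1 := continuous_parametric_integral_of_continuous (μ := volume)
    (f := fun (x z : Rd d) => radialKernel z * u (x - h • z))
    (((continuous_radialKernel d).comp continuous_snd).mul (hu.comp (by fun_prop)))
    (isCompact_closedBall (0 : Rd d) 1)
  refine h1.congr fun x => ?_
  refine setIntegral_eq_integral_of_forall_compl_eq_zero fun z hz => ?_
  rw [radialKernel_eq_zero (by simpa using (not_le.1 (by simpa using hz : ¬ ‖z‖ ≤ 1)).le),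
    zero_mul]

theorem abs_mollify_sub_self_le {d : ℕ} {u : Rd d → ℝ} (hu : Continuous u) {h c : ℝ} {x : Rd d}
    (huc : ∀ y ∈ Metric.closedBall x |h|, |u y - u x| ≤ c) : |mollify h u x - u x| ≤ c := by
  have h1 := abs_mollify_le (u := fun y => u y - u x) (hu.sub continuous_const) huc
  rwa [mollify_sub hu continuous_const, mollify_const] at h1

theorem tendsto_mollify {d : ℕ} {u : Rd d → ℝ} (hu : Continuous u) (x : Rd d) :
    Filter.Tendsto (fun h => mollify h u x) (nhds 0) (nhds (u x)) := by
  rw [Metric.tendsto_nhds]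
  intro ε hε
  obtain ⟨δ, hδ, hδu⟩ := Metric.continuous_iff.1 hu x (ε / 2) (half_pos hε)
  filter_upwards [Metric.ball_mem_nhds (0 : ℝ) hδ] with h hh
  rw [Real.dist_eq]
  refine (abs_mollify_sub_self_le hu (c := ε / 2) fun y hy => ?_).trans_lt (half_lt_self hε)
  have hh' : |h| < δ := by simpa using hh
  exact (hδu y ((Metric.mem_closedBall.1 hy).trans_lt hh')).le

theorem contDiff_fderiv_apply {d : ℕ} {v : Rd d → ℝ} (hv : ContDiff ℝ 2 v) (e : Rd d) :
    ContDiff ℝ 1 (fun y => fderiv ℝ v y e) :=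
  (hv.fderiv_right (m := 1) (by norm_num)).clm_apply contDiff_const

theorem continuous_lapRd {d : ℕ} {v : Rd d → ℝ} (hv : ContDiff ℝ 2 v) :
    Continuous (lapRd v) := by
  refine continuous_finsetSum _ fun j _ => ?_
  exact ((contDiff_fderiv_apply hv _).continuous_fderiv (by norm_num)).clm_apply
    continuous_const

theorem lapRd_neg {d : ℕ} (v : Rd d → ℝ) (x : Rd d) :
    lapRd (fun y => -v y) x = -lapRd v x := by
  simp [lapRd, fderiv_fun_neg]

theorem hasDerivAt_mollify {d : ℕ} {v : Rd d → ℝ} (hv : ContDiff ℝ 2 v) (x : Rd d) (t : ℝ) :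
    HasDerivAt (fun h => mollify h v x)
      (t * ∫ z : Rd d, kernelPotential z * lapRd v (x - t • z)) t := by
  have hv1 : ContDiff ℝ 1 v := hv.of_le (by norm_num)
  have hdv : Continuous (fderiv ℝ v) := hv1.continuous_fderiv (by norm_num)
  -- differentiate under the integral sign
  have hF' : Continuous (fun p : ℝ × Rd d =>
      radialKernel p.2 * fderiv ℝ v (x - p.1 • p.2) (-p.2)) :=
    ((continuous_radialKernel d).comp continuous_snd).mul
      ((hdv.comp (by fun_prop)).clm_apply (by fun_prop))
  obtain ⟨C, hC⟩ := ((isCompact_Icc (a := t - 1) (b := t + 1)).prod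
    (isCompact_closedBall (0 : Rd d) 1)).exists_bound_of_continuousOn hF'.continuousOn
  have hD : HasDerivAt (fun h => mollify h v x)
      (∫ z : Rd d, radialKernel z * fderiv ℝ v (x - t • z) (-z)) t := by
    refine (hasDerivAt_integral_of_dominated_loc_of_deriv_le (μ := volume)
      (F := fun h z => radialKernel z * v (x - h • z))
      (F' := fun h z => radialKernel z * fderiv ℝ v (x - h • z) (-z))
      (bound := (Metric.closedBall (0 : Rd d) 1).indicator fun _ => C)
      (Icc_mem_nhds (by linarith : t - 1 < t) (by linarith : t < t + 1)) ?_ ?_ ?_ ?_ ?_ ?_).2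
    · exact Filter.Eventually.of_forall fun h =>
        (integrable_mollify_integrand hv1.continuous h x).aestronglyMeasurable
    · exact integrable_mollify_integrand hv1.continuous t x
    · exact (hF'.comp (by fun_prop : Continuous fun z : Rd d => (t, z))).aestronglyMeasurable
    · refine Filter.Eventually.of_forall fun z h hh => ?_
      by_cases hz : z ∈ Metric.closedBall (0 : Rd d) 1
      · rw [Set.indicator_of_mem hz]
        exact hC (h, z) ⟨hh, hz⟩
      · rw [Set.indicator_of_notMem hz, radialKernel_eq_zero, zero_mul, norm_zero]
        simpa using (not_le.1 (by simpa using hz : ¬ ‖z‖ ≤ 1)).le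
    · exact (integrable_indicator_iff measurableSet_closedBall).2
        (integrableOn_const measure_closedBall_lt_top.ne)
    · refine Filter.Eventually.of_forall fun z h _ => ?_
      have h1 : HasDerivAt (fun h : ℝ => x - h • z) (-z) h := by
        simpa using ((hasDerivAt_id h).smul_const z).const_sub x
      exact ((hv1.differentiable (by norm_num) _).hasFDerivAt.comp_hasDerivAt h h1).const_mul _
  refine hD.congr_deriv ?_
  -- integrate by parts
  have hcomp : ∀ j : Fin d, ∀ z : Rd d,
      HasFDerivAt (fun z : Rd d => fderiv ℝ v (x - t • z) (EuclideanSpace.single j (1 : ℝ)))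
        (-(t • fderiv ℝ (fun y => fderiv ℝ v y (EuclideanSpace.single j (1 : ℝ)))
          (x - t • z))) z := by
    intro j z
    have h1 : HasFDerivAt (fun z : Rd d => x - t • z)
        (-(t • ContinuousLinearMap.id ℝ (Rd d))) z :=
      ((hasFDerivAt_id z).const_smul t).const_sub x
    have h2 := ((contDiff_fderiv_apply hv (EuclideanSpace.single j (1 : ℝ))).differentiable
      (by norm_num) (x - t • z)).hasFDerivAt.comp z h1
    refine h2.congr_fderiv ?_
    ext w
    simp
  have hibp : ∀ j : Fin d,
      ∫ z : Rd d, radialKernel z * (z j *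
        fderiv ℝ v (x - t • z) (EuclideanSpace.single j (1 : ℝ))) =
      -(t * ∫ z : Rd d, kernelPotential z *
        fderiv ℝ (fun y => fderiv ℝ v y (EuclideanSpace.single j (1 : ℝ))) (x - t • z)
          (EuclideanSpace.single j (1 : ℝ))) := by
    intro j
    set e : Rd d := EuclideanSpace.single j (1 : ℝ) with he
    set g : Rd d → ℝ := fun z => fderiv ℝ v (x - t • z) e with hg
    have hgc : Continuous g := (hdv.comp (by fun_prop)).clm_apply continuous_const
    have hg' : ∀ z, fderiv ℝ g z e = -(t * fderiv ℝ (fun y => fderiv ℝ v y e) (x - t • z) e) :=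
      fun z => by rw [(hcomp j z).fderiv]; simp [he]
    have hg'c : Continuous fun z => fderiv ℝ g z e := by
      simp_rw [hg']
      exact (continuous_const.mul ((((contDiff_fderiv_apply hv e).continuous_fderiv
        (by norm_num)).comp (by fun_prop)).clm_apply continuous_const)).neg
    have hp' : ∀ z : Rd d, fderiv ℝ kernelPotential z e = -(radialKernel z * z j) := fun z => by
      rw [(hasFDerivAt_kernelPotential z).fderiv, he]
      simp [EuclideanSpace.inner_single_right]
    have key := integral_mul_fderiv_eq_neg_fderiv_mul_of_integrable (μ := volume)
      (f := kernelPotential) (g := g) (v := e) ?_ ?_ ?_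
      (fun z _ => (hasFDerivAt_kernelPotential z).differentiableAt)
      (fun z _ => (hcomp j z).differentiableAt)
    · simp_rw [hg', hp'] at key
      simp only [mul_neg, neg_mul, integral_neg, neg_neg, mul_left_comm _ t,
        integral_const_mul] at key
      rw [key]
      simp only [mul_assoc, hg]
    · simp_rw [hp', neg_mul, mul_assoc]
      exact (integrable_radialKernel_mul (by fun_prop)).neg
    · exact ((continuous_kernelPotential d).mul hg'c).integrable_of_hasCompactSupport
        (hasCompactSupport_kernelPotential d).mul_right
    · exact ((continuous_kernelPotential d).mul hgc).integrable_of_hasCompactSupport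
        (hasCompactSupport_kernelPotential d).mul_right
  have hexp : ∀ z : Rd d, radialKernel z * fderiv ℝ v (x - t • z) (-z) =
      -∑ j : Fin d, radialKernel z * (z j *
        fderiv ℝ v (x - t • z) (EuclideanSpace.single j (1 : ℝ))) := by
    intro z
    have hz : z = ∑ j : Fin d, z j • EuclideanSpace.single j (1 : ℝ) := by
      simpa using ((EuclideanSpace.basisFun (Fin d) ℝ).sum_repr z).symm
    rw [map_neg, mul_neg]
    congr 1
    conv_lhs => rw [show fderiv ℝ v (x - t • z) z =
      fderiv ℝ v (x - t • z) (∑ j : Fin d, z j • EuclideanSpace.single j (1 : ℝ)) by rw [← hz]]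
    simp only [map_sum, map_smul, smul_eq_mul, Finset.mul_sum]
  simp_rw [hexp, integral_neg, lapRd, Finset.mul_sum]
  rw [integral_finsetSum, integral_finsetSum, Finset.mul_sum, ← Finset.sum_neg_distrib]
  · refine Finset.sum_congr rfl fun j _ => ?_
    rw [hibp j, neg_neg]
  · intro j _
    exact ((continuous_kernelPotential d).mul ((((contDiff_fderiv_apply hv _).continuous_fderiv
      (by norm_num)).comp (by fun_prop)).clm_apply continuous_const)).integrable_of_hasCompactSupport
        (hasCompactSupport_kernelPotential d).mul_right
  · intro j _
    refine integrable_radialKernel_mul ?_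
    exact (by fun_prop : Continuous fun z : Rd d => z j).mul
      ((hdv.comp (by fun_prop)).clm_apply continuous_const)

theorem le_mollify_sub_of_le_lapRd {d : ℕ} {v : Rd d → ℝ} (hv : ContDiff ℝ 2 v) {x : Rd d}
    {h A : ℝ} (hh : 0 ≤ h) (hA : ∀ y ∈ Metric.closedBall x h, A ≤ lapRd v y) :
    potentialMass d / 2 * h ^ 2 * A ≤ mollify h v x - v x := by
  set m : ℝ → ℝ := fun t => mollify t v x - potentialMass d / 2 * t ^ 2 * A with hm
  have hderiv : ∀ t, HasDerivAt m (t * (∫ z : Rd d, kernelPotential z * lapRd v (x - t • z)) -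
      t * (potentialMass d * A)) t := by
    intro t
    have h1 : HasDerivAt (fun t : ℝ => potentialMass d / 2 * t ^ 2 * A)
        (t * (potentialMass d * A)) t := by
      refine ((((hasDerivAt_id t).pow 2).const_mul (potentialMass d / 2)).mul_const
        A).congr_deriv ?_
      simp
      ring
    exact (hasDerivAt_mollify hv x t).sub h1
  have hmono : MonotoneOn m (Set.Icc 0 h) := by
    refine monotoneOn_of_deriv_nonneg (convex_Icc 0 h)
      (fun t _ => (hderiv t).continuousAt.continuousWithinAt)
      (fun t _ => (hderiv t).differentiableAt.differentiableWithinAt) fun t ht => ?_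
    rw [interior_Icc] at ht
    rw [(hderiv t).deriv, ← mul_sub]
    refine mul_nonneg ht.1.le (sub_nonneg.2 ?_)
    rw [potentialMass, ← integral_mul_const]
    refine integral_mono (((continuous_kernelPotential d).integrable_of_hasCompactSupport
      (hasCompactSupport_kernelPotential d)).mul_const A)
      (((continuous_kernelPotential d).mul
        ((continuous_lapRd hv).comp (by fun_prop))).integrable_of_hasCompactSupport
        (hasCompactSupport_kernelPotential d).mul_right) fun z => ?_
    rcases le_or_gt 1 ‖z‖ with hz | hz
    · simp [kernelPotential_eq_zero hz]
    · refine mul_le_mul_of_nonneg_left (hA _ ?_) (kernelPotential_nonneg z)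
      have h2 : t * ‖z‖ ≤ h := by nlinarith [norm_nonneg z, ht.1, ht.2]
      simpa [norm_smul, abs_of_pos ht.1] using h2
  have := hmono (Set.left_mem_Icc.2 hh) (Set.right_mem_Icc.2 hh) hh
  have h0 : mollify 0 v x = v x := by
    simp [mollify, integral_mul_const, integral_radialKernel]
  simp only [hm, h0] at this
  linarith

theorem mollify_sub_le_of_lapRd_le {d : ℕ} {v : Rd d → ℝ} (hv : ContDiff ℝ 2 v) {x : Rd d}
    {h B : ℝ} (hh : 0 ≤ h) (hB : ∀ y ∈ Metric.closedBall x h, lapRd v y ≤ B) :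
    mollify h v x - v x ≤ potentialMass d / 2 * h ^ 2 * B := by
  have h1 := le_mollify_sub_of_le_lapRd (A := -B) hv.neg hh
    fun y hy => by simpa only [lapRd_neg, neg_le_neg_iff] using hB y hy
  have h2 : mollify h (fun y => -v y) x = -mollify h v x := by
    simpa using mollify_const_mul v (-1) h x
  simp only [h2] at h1
  linarith

theorem abs_mollify_sub_le {d : ℕ} {v : Rd d → ℝ} (hv : ContDiff ℝ 2 v) {x : Rd d}
    {h B : ℝ} (hh : 0 ≤ h) (hB : ∀ y ∈ Metric.closedBall x h, |lapRd v y| ≤ B) :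
    |mollify h v x - v x| ≤ potentialMass d / 2 * h ^ 2 * B := by
  have h1 := le_mollify_sub_of_le_lapRd hv hh fun y hy => (abs_le.1 (hB y hy)).1
  have h2 := mollify_sub_le_of_lapRd_le hv hh fun y hy => (abs_le.1 (hB y hy)).2
  exact abs_le.2 ⟨by linarith, h2⟩

theorem tendsto_mollify_sub_div {d : ℕ} {v : Rd d → ℝ} (hv : ContDiff ℝ 2 v) (x : Rd d) :
    Filter.Tendsto (fun h => (mollify h v x - v x) / h ^ 2) (nhdsWithin 0 (Set.Ioi 0))
      (nhds (potentialMass d / 2 * lapRd v x)) := by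
  have hc := potentialMass_pos d
  rw [Metric.tendsto_nhds]
  intro ε hε
  obtain ⟨δ, hδ, hδv⟩ := Metric.continuous_iff.1 (continuous_lapRd hv) x
    (ε / potentialMass d) (by positivity)
  filter_upwards [Ioo_mem_nhdsGT hδ] with h hh
  have hb : ∀ y ∈ Metric.closedBall x h, |lapRd v y - lapRd v x| ≤ ε / potentialMass d :=
    fun y hy => (hδv y ((Metric.mem_closedBall.1 hy).trans_lt hh.2)).le
  have h1 := le_mollify_sub_of_le_lapRd (A := lapRd v x - ε / potentialMass d) hv hh.1.le
    fun y hy => by linarith [(abs_le.1 (hb y hy)).1]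
  have h2 := mollify_sub_le_of_lapRd_le (B := lapRd v x + ε / potentialMass d) hv hh.1.le
    fun y hy => by linarith [(abs_le.1 (hb y hy)).2]
  have hh2 : 0 < h ^ 2 := pow_pos hh.1 2
  rw [show potentialMass d / 2 * h ^ 2 * (lapRd v x - ε / potentialMass d) =
    (potentialMass d / 2 * lapRd v x - ε / 2) * h ^ 2 by field_simp, ← le_div_iff₀ hh2] at h1
  rw [show potentialMass d / 2 * h ^ 2 * (lapRd v x + ε / potentialMass d) =
    (potentialMass d / 2 * lapRd v x + ε / 2) * h ^ 2 by field_simp, ← div_le_iff₀ hh2] at h2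
  rw [Real.dist_eq, abs_lt]
  constructor <;> linarith

theorem hasCompactSupport_uncurry_of_norm_gt {d : ℕ} {f : Rd d → Rd d → ℝ} {R S : ℝ}
    (h1 : ∀ x z, R < ‖x‖ → f x z = 0) (h2 : ∀ x z, S < ‖z‖ → f x z = 0) :
    HasCompactSupport f.uncurry := by
  refine HasCompactSupport.intro
    ((isCompact_closedBall (0 : Rd d) R).prod (isCompact_closedBall (0 : Rd d) S)) ?_
  rintro ⟨x, z⟩ hxz
  simp only [Set.mem_prod, mem_closedBall_zero_iff, not_and_or, not_le] at hxz
  rcases hxz with h | h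
  · exact h1 x z h
  · exact h2 x z h

theorem HasCompactSupport.exists_norm_gt_eq_zero {d : ℕ} {χ : Rd d → ℝ}
    (hχ : HasCompactSupport χ) : ∃ R : ℝ, 0 ≤ R ∧ ∀ x, R < ‖x‖ → χ x = 0 := by
  obtain ⟨R, hR⟩ := hχ.isBounded.subset_closedBall 0
  refine ⟨max R 0, le_max_right _ _, fun x hx => image_eq_zero_of_notMem_tsupport fun h => ?_⟩
  have := hR h
  rw [mem_closedBall_zero_iff] at this
  exact absurd hx (not_lt.2 (this.trans (le_max_left _ _)))

theorem mollify_eq_zero_of_norm_gt {d : ℕ} {χ : Rd d → ℝ} {R h : ℝ} {x : Rd d}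
    (hR : ∀ x, R < ‖x‖ → χ x = 0) (hx : R + |h| < ‖x‖) : mollify h χ x = 0 := by
  refine (integral_congr_ae (Filter.Eventually.of_forall fun z => ?_)).trans
    (integral_zero _ _)
  rcases le_or_gt 1 ‖z‖ with hz | hz
  · simp [radialKernel_eq_zero hz]
  · have h1 : ‖h • z‖ ≤ |h| := by
      simpa [norm_smul] using mul_le_of_le_one_right (abs_nonneg h) hz.le
    simp [hR (x - h • z) (by linarith [norm_sub_norm_le x (h • z)])]

theorem integral_mollify_mul {d : ℕ} {u χ : Rd d → ℝ} (hu : Continuous u) (hχ : Continuous χ)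
    (hχs : HasCompactSupport χ) (h : ℝ) :
    ∫ x, mollify h u x * χ x = ∫ x, u x * mollify h χ x := by
  obtain ⟨R, -, hR⟩ := hχs.exists_norm_gt_eq_zero
  have hρ := continuous_radialKernel d
  calc ∫ x, mollify h u x * χ x
      = ∫ x, ∫ z, radialKernel z * u (x - h • z) * χ x := by
        simp only [mollify, integral_mul_const]
    _ = ∫ z, ∫ x, radialKernel z * u (x - h • z) * χ x := by
        refine integral_integral_swap_of_hasCompactSupport ?_
          (hasCompactSupport_uncurry_of_norm_gt (R := R) (S := 1) ?_ ?_)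
        · exact (((hρ.comp continuous_snd).mul (hu.comp (by fun_prop))).mul
            (hχ.comp continuous_fst))
        · exact fun x z hx => by rw [hR x hx, mul_zero]
        · exact fun x z hz => by rw [radialKernel_eq_zero hz.le, zero_mul, zero_mul]
    _ = ∫ z, ∫ x, radialKernel z * u x * χ (x + h • z) := by
        refine integral_congr_ae (Filter.Eventually.of_forall fun z => ?_)
        simpa using (integral_add_right_eq_self
          (fun x => radialKernel z * u (x - h • z) * χ x) (h • z)).symm
    _ = ∫ z, ∫ x, radialKernel z * u x * χ (x - h • z) := by
        rw [← integral_neg_eq_self]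
        simp [radialKernel_neg, sub_eq_add_neg]
    _ = ∫ x, ∫ z, radialKernel z * u x * χ (x - h • z) := by
        refine (integral_integral_swap_of_hasCompactSupport ?_
          (hasCompactSupport_uncurry_of_norm_gt (R := R + |h|) (S := 1) ?_ ?_)).symm
        · exact (((hρ.comp continuous_snd).mul (hu.comp continuous_fst)).mul
            (hχ.comp (by fun_prop)))
        · intro x z hx
          rcases le_or_gt 1 ‖z‖ with hz | hz
          · rw [radialKernel_eq_zero hz, zero_mul, zero_mul]
          · have h1 : ‖h • z‖ ≤ |h| := by
              simpa [norm_smul] using mul_le_of_le_one_right (abs_nonneg h) hz.le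
            rw [hR (x - h • z) (by linarith [norm_sub_norm_le x (h • z)]), mul_zero]
        · exact fun x z hz => by rw [radialKernel_eq_zero hz.le, zero_mul, zero_mul]
    _ = ∫ x, u x * mollify h χ x := by
        simp only [mollify, mul_comm (radialKernel _) (u _), mul_assoc, integral_const_mul]

theorem mollify_comm {d : ℕ} {u : Rd d → ℝ} (hu : Continuous u) (s t : ℝ) (x : Rd d) :
    mollify s (mollify t u) x = mollify t (mollify s u) x := by
  have hρ := continuous_radialKernel d
  simp only [mollify, ← integral_const_mul]
  rw [integral_integral_swap_of_hasCompactSupport]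
  · simp only [sub_right_comm _ (s • _) (t • _), mul_left_comm]
  · exact (hρ.comp continuous_fst).mul ((hρ.comp continuous_snd).mul (hu.comp (by fun_prop)))
  · refine hasCompactSupport_uncurry_of_norm_gt (R := 1) (S := 1) ?_ ?_
    · exact fun x z hx => by rw [radialKernel_eq_zero hx.le, zero_mul]
    · exact fun x z hz => by rw [radialKernel_eq_zero hz.le, zero_mul, mul_zero]

open scoped Convolution in
theorem mollify_eq_convolution {d : ℕ} (w : Rd d → ℝ) {s : ℝ} (hs : s ≠ 0) (x : Rd d) :
    mollify s w x =
      ((fun y => w (s • y)) ⋆[ContinuousLinearMap.lsmul ℝ ℝ, volume] radialKernel)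
        (s⁻¹ • x) := by
  rw [mollify, ← integral_sub_left_eq_self _ volume (s⁻¹ • x), convolution_def]
  refine integral_congr_ae (Filter.Eventually.of_forall fun y => ?_)
  simp [smul_sub, smul_smul, hs, mul_comm]

theorem contDiff_mollify {d : ℕ} {w : Rd d → ℝ} (hw : Continuous w) {s : ℝ} (hs : s ≠ 0) :
    ContDiff ℝ (⊤ : ℕ∞) (mollify s w) := by
  rw [funext (mollify_eq_convolution w hs)]
  have h1 : Continuous fun y : Rd d => w (s • y) := by fun_prop
  exact ((hasCompactSupport_radialKernel d).contDiff_convolution_right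
    (ContinuousLinearMap.lsmul ℝ ℝ) h1.locallyIntegrable (contDiff_radialKernel d)).comp
    (contDiff_const_smul s⁻¹)

theorem contDiff_two_mollify {d : ℕ} {w : Rd d → ℝ} (hw : Continuous w) {s : ℝ} (hs : s ≠ 0) :
    ContDiff ℝ 2 (mollify s w) := by
  exact_mod_cast contDiff_infty.1 (contDiff_mollify hw hs) 2

/-- The kernel at scale `δ` centred at `x`, as a test function. -/
def testKernel {d : ℕ} (δ : ℝ) (x y : Rd d) : ℝ :=
  |(δ ^ d)⁻¹| * radialKernel (δ⁻¹ • (x - y))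

theorem testKernel_nonneg {d : ℕ} (δ : ℝ) (x y : Rd d) : 0 ≤ testKernel δ x y :=
  mul_nonneg (abs_nonneg _) (radialKernel_nonneg _)

theorem contDiff_testKernel {d : ℕ} (δ : ℝ) (x : Rd d) :
    ContDiff ℝ (⊤ : ℕ∞) (testKernel δ x) :=
  contDiff_const.mul ((contDiff_radialKernel d).comp
    ((contDiff_const.sub contDiff_id).const_smul δ⁻¹))

theorem tsupport_testKernel_subset {d : ℕ} {δ : ℝ} (hδ : 0 < δ) (x : Rd d) :
    tsupport (testKernel δ x) ⊆ Metric.closedBall x δ := by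
  refine closure_minimal (fun y hy => ?_) Metric.isClosed_closedBall
  by_contra hxy
  rw [Metric.mem_closedBall, not_le, dist_comm, dist_eq_norm] at hxy
  refine hy ?_
  rw [testKernel, radialKernel_eq_zero, mul_zero]
  rw [norm_smul, norm_inv, Real.norm_of_nonneg hδ.le, inv_mul_eq_div, one_le_div hδ]
  exact hxy.le

theorem hasCompactSupport_testKernel {d : ℕ} {δ : ℝ} (hδ : 0 < δ) (x : Rd d) :
    HasCompactSupport (testKernel δ x) :=
  (isCompact_closedBall x δ).of_isClosed_subset (isClosed_tsupport _)
    (tsupport_testKernel_subset hδ x)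

theorem mollify_eq_integral_testKernel {d : ℕ} (w : Rd d → ℝ) {δ : ℝ} (hδ : 0 < δ)
    (x : Rd d) : mollify δ w x = ∫ y, w y * testKernel δ x y := by
  have h1 := Measure.integral_comp_smul (volume : Measure (Rd d))
    (fun y => radialKernel (δ⁻¹ • y) * w (x - y)) δ
  simp only [smul_smul, inv_mul_cancel₀ hδ.ne', one_smul, finrank_euclideanSpace,
    Fintype.card_fin, smul_eq_mul] at h1
  rw [mollify, h1, ← integral_sub_left_eq_self _ volume x, ← integral_const_mul]
  refine integral_congr_ae (Filter.Eventually.of_forall fun y => ?_)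
  simp only [testKernel, sub_sub_cancel]
  ring

theorem integral_testKernel {d : ℕ} {δ : ℝ} (hδ : 0 < δ) (x : Rd d) :
    ∫ y, testKernel δ x y = 1 := by
  simpa [mollify_const] using (mollify_eq_integral_testKernel (fun _ => 1) hδ x).symm

theorem HasCompactSupport.lapRd {d : ℕ} {χ : Rd d → ℝ} (hχ : HasCompactSupport χ) :
    HasCompactSupport (lapRd χ) := by
  refine hχ.of_isClosed_subset (isClosed_tsupport _) (closure_minimal (fun x hx => ?_)
    (isClosed_tsupport _))
  by_contra hxs
  refine hx (Finset.sum_eq_zero fun j _ => ?_)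
  have h0 : (fun y => fderiv ℝ χ y (EuclideanSpace.single j (1 : ℝ))) =ᶠ[nhds x]
      fun _ => 0 := by
    filter_upwards [(isClosed_tsupport χ).isOpen_compl.mem_nhds hxs] with y hy
    have : χ =ᶠ[nhds y] fun _ => 0 := notMem_tsupport_iff_eventuallyEq.1 hy
    rw [this.fderiv_eq]
    simp
  rw [h0.fderiv_eq]
  simp

/-- The rescaled averaging operators converge to a multiple of the Laplacian in the sense of
distributions, also along a uniformly convergent sequence of functions. -/
theorem tendsto_integral_mollify_sub_div_mul {d : ℕ} {u : Rd d → ℝ} {U : ℕ → Rd d → ℝ}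
    {h : ℕ → ℝ} {M : ℝ} (hU : ∀ n, Continuous (U n)) (hUM : ∀ n x, |U n x| ≤ M)
    (hUu : ∀ x, Filter.Tendsto (fun n => U n x) Filter.atTop (nhds (u x)))
    (hh : Filter.Tendsto h Filter.atTop (nhdsWithin 0 (Set.Ioi 0)))
    (hh0 : ∀ n, 0 < h n) (hh1 : ∀ n, h n ≤ 1)
    {χ : Rd d → ℝ} (hχ : ContDiff ℝ (⊤ : ℕ∞) χ) (hχs : HasCompactSupport χ) :
    Filter.Tendsto (fun n => ∫ x, (mollify (h n) (U n) x - U n x) / h n ^ 2 * χ x)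
      Filter.atTop (nhds (potentialMass d / 2 * ∫ x, u x * lapRd χ x)) := by
  have hχ2 : ContDiff ℝ 2 χ := by exact_mod_cast contDiff_infty.1 hχ 2
  have hχc := hχ.continuous
  obtain ⟨R, hR0, hR⟩ := hχs.exists_norm_gt_eq_zero
  obtain ⟨B, hB⟩ := (continuous_lapRd hχ2).bounded_above_of_compact_support hχs.lapRd
  have hB0 : 0 ≤ B := (norm_nonneg _).trans (hB 0)
  have hM0 : 0 ≤ M := (abs_nonneg _).trans (hUM 0 0)
  have hc := potentialMass_pos d
  have hswap : ∀ n, ∫ x, (mollify (h n) (U n) x - U n x) / h n ^ 2 * χ x =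
      ∫ x, U n x * ((mollify (h n) χ x - χ x) / h n ^ 2) := by
    intro n
    have hi : ∀ {g : Rd d → ℝ}, Continuous g → Integrable fun x => g x * χ x := fun hg =>
      (hg.mul hχc).integrable_of_hasCompactSupport hχs.mul_left
    have hm : HasCompactSupport (mollify (h n) χ) :=
      HasCompactSupport.intro (isCompact_closedBall 0 (R + |h n|)) fun x hx =>
        mollify_eq_zero_of_norm_gt hR (by simpa using hx)
    have hi' : Integrable fun x => U n x * mollify (h n) χ x :=
      ((hU n).mul (continuous_mollify hχc _)).integrable_of_hasCompactSupport hm.mul_left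
    have e1 : ∀ x, (mollify (h n) (U n) x - U n x) / h n ^ 2 * χ x =
        (h n ^ 2)⁻¹ * (mollify (h n) (U n) x * χ x - U n x * χ x) := fun x => by ring
    have e2 : ∀ x, U n x * ((mollify (h n) χ x - χ x) / h n ^ 2) =
        (h n ^ 2)⁻¹ * (U n x * mollify (h n) χ x - U n x * χ x) := fun x => by ring
    simp_rw [e1, e2, integral_const_mul]
    rw [integral_sub (hi (continuous_mollify (hU n) _)) (hi (hU n)),
      integral_sub hi' (hi (hU n)), integral_mollify_mul (hU n) hχc hχs]
  simp_rw [hswap, ← integral_const_mul]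
  refine tendsto_integral_of_dominated_convergence
    ((Metric.closedBall (0 : Rd d) (R + 1)).indicator fun _ => M * (potentialMass d / 2 * B))
    (fun n => ((hU n).mul (((continuous_mollify hχc _).sub hχc).div_const
      _)).aestronglyMeasurable) ?_ (fun n => Filter.Eventually.of_forall fun x => ?_)
    (Filter.Eventually.of_forall fun x => ?_)
  · exact (integrable_indicator_iff measurableSet_closedBall).2
      (integrableOn_const measure_closedBall_lt_top.ne)
  · by_cases hx : x ∈ Metric.closedBall (0 : Rd d) (R + 1)
    · rw [Set.indicator_of_mem hx, norm_mul]
      refine mul_le_mul (hUM n x) ?_ (norm_nonneg _) hM0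
      have h1 := abs_mollify_sub_le (x := x) hχ2 (hh0 n).le fun y _ => hB y
      rw [norm_div, Real.norm_eq_abs, Real.norm_of_nonneg (sq_nonneg _),
        div_le_iff₀ (pow_pos (hh0 n) 2)]
      linarith
    · have hx' : R + 1 < ‖x‖ := by simpa using hx
      rw [Set.indicator_of_notMem hx, hR x (by linarith), mollify_eq_zero_of_norm_gt hR]
      · simp
      · rw [abs_of_pos (hh0 n)]
        linarith [hh1 n]
  · have h1 := (hUu x).mul ((tendsto_mollify_sub_div hχ2 x).comp hh)
    refine h1.trans_eq ?_
    congr 1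
    ring

/-- A sequence of positive scales tending to zero. -/
def scale (n : ℕ) : ℝ := 1 / ((n : ℝ) + 1)

theorem scale_pos (n : ℕ) : 0 < scale n := by unfold scale; positivity

theorem scale_le_one (n : ℕ) : scale n ≤ 1 :=
  (div_le_one (by positivity)).2 (by linarith [Nat.cast_nonneg (α := ℝ) n])

theorem tendsto_scale : Filter.Tendsto scale Filter.atTop (nhdsWithin 0 (Set.Ioi 0)) :=
  tendsto_nhdsWithin_iff.2 ⟨tendsto_one_div_add_atTop_nhds_zero_nat,
    Filter.Eventually.of_forall scale_pos⟩

theorem lapRd_mollify {d : ℕ} {u : Rd d → ℝ} (hu : Continuous u) {M : ℝ}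
    (hM : ∀ x, |u x| ≤ M) {δ : ℝ} (hδ : 0 < δ) (x : Rd d) :
    lapRd (mollify δ u) x = ∫ y, u y * lapRd (testKernel δ x) y := by
  have t1 := tendsto_integral_mollify_sub_div_mul (U := fun _ => u) (fun _ => hu) (fun _ => hM)
    (fun x => tendsto_const_nhds)
    tendsto_scale scale_pos scale_le_one (contDiff_testKernel δ x)
    (hasCompactSupport_testKernel hδ x)
  have t2 := (tendsto_mollify_sub_div (contDiff_two_mollify hu hδ.ne') x).comp tendsto_scale
  have he : ∀ n, (mollify (scale n) (mollify δ u) x - mollify δ u x) / scale n ^ 2 =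
      ∫ y, (mollify (scale n) u y - u y) / scale n ^ 2 * testKernel δ x y := by
    intro n
    rw [← mollify_eq_integral_testKernel (fun y => (mollify (scale n) u y - u y) / scale n ^ 2)
      hδ, mollify_comm hu, ← mollify_sub (continuous_mollify hu _) hu, div_eq_inv_mul,
      ← mollify_const_mul]
    simp only [div_eq_inv_mul]
  have := tendsto_nhds_unique (t2.congr he) t1
  exact mul_left_cancel₀ (by linarith [potentialMass_pos d]) this

theorem PeriodicRd.periodic_sum {d : ℕ} {α : Type*} {f : Rd d → α} (hf : PeriodicRd f)
    (n : Fin d → ℤ) (s : Finset (Fin d)) :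
    Function.Periodic f (∑ j ∈ s, n j • ((2 * π) • EuclideanSpace.single j (1 : ℝ))) := by
  classical
  induction s using Finset.induction_on with
  | empty => intro x; simp
  | insert j s hj ih =>
    rw [Finset.sum_insert hj]
    have h1 : Function.Periodic f ((2 * π) • EuclideanSpace.single j (1 : ℝ)) := fun x => hf x j
    exact (h1.zsmul (n j)).add_period ih

theorem PeriodicRd.exists_mem_closedBall {d : ℕ} {α : Type*} {f : Rd d → α} (hf : PeriodicRd f)
    (x : Rd d) : ∃ y ∈ Metric.closedBall (0 : Rd d) (√(d * (2 * π) ^ 2)), f y = f x := by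
  have hpi : 0 < 2 * π := Real.two_pi_pos
  set v : Rd d := ∑ j, (-⌊x j / (2 * π)⌋) • ((2 * π) • EuclideanSpace.single j (1 : ℝ)) with hv
  refine ⟨x + v, ?_, hf.periodic_sum _ _ x⟩
  have hcoord : ∀ j, (x + v) j = x j - ⌊x j / (2 * π)⌋ * (2 * π) := by
    intro j
    have : v j = -(⌊x j / (2 * π)⌋ * (2 * π)) := by
      rw [hv]
      simp [Finset.sum_apply, Pi.single_apply, mul_comm]
    rw [PiLp.add_apply, this, sub_eq_add_neg]
  rw [mem_closedBall_zero_iff]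
  refine Real.le_sqrt_of_sq_le ?_
  rw [EuclideanSpace.norm_sq_eq]
  have : ∀ j ∈ Finset.univ, ‖(x + v) j‖ ^ 2 ≤ (2 * π) ^ 2 := by
    intro j _
    have h1 : 0 ≤ x j - ⌊x j / (2 * π)⌋ * (2 * π) := Int.sub_floor_div_mul_nonneg _ hpi
    have h2 : x j - ⌊x j / (2 * π)⌋ * (2 * π) < 2 * π := Int.sub_floor_div_mul_lt _ hpi
    rw [hcoord, Real.norm_of_nonneg h1]
    exact pow_le_pow_left₀ h1 h2.le 2
  simpa using Finset.sum_le_sum this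

theorem PeriodicRd.exists_bound {d : ℕ} {F : Type*} [SeminormedAddCommGroup F] {f : Rd d → F}
    (hf : PeriodicRd f) (hfc : Continuous f) : ∃ C, ∀ x, ‖f x‖ ≤ C := by
  obtain ⟨C, hC⟩ := (isCompact_closedBall (0 : Rd d)
    (√(d * (2 * π) ^ 2))).exists_bound_of_continuousOn hfc.continuousOn
  refine ⟨C, fun x => ?_⟩
  obtain ⟨y, hy, hyx⟩ := hf.exists_mem_closedBall x
  exact hyx ▸ hC y hy

theorem PeriodicRd.exists_forall_le {d : ℕ} {f : Rd d → ℝ} (hf : PeriodicRd f)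
    (hfc : Continuous f) : ∃ x₀, ∀ x, f x ≤ f x₀ := by
  obtain ⟨x₀, -, hx₀⟩ := (isCompact_closedBall (0 : Rd d)
    (√(d * (2 * π) ^ 2))).exists_isMaxOn
      ⟨0, Metric.mem_closedBall_self (Real.sqrt_nonneg _)⟩ hfc.continuousOn
  refine ⟨x₀, fun x => ?_⟩
  obtain ⟨y, hy, hyx⟩ := hf.exists_mem_closedBall x
  exact hyx ▸ hx₀ hy

theorem integrable_mul_lapRd {d : ℕ} {u χ : Rd d → ℝ} (hu : Continuous u)
    (hχ : ContDiff ℝ (⊤ : ℕ∞) χ) (hχs : HasCompactSupport χ) :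
    Integrable fun x => u x * lapRd χ x :=
  (hu.mul (continuous_lapRd (by exact_mod_cast contDiff_infty.1 hχ 2))).integrable_of_hasCompactSupport
    hχs.lapRd.mul_left

/-- `w` is subharmonic on `Ω` in the sense of distributions. -/
def DistribSubharmonicOn {d : ℕ} (w : Rd d → ℝ) (Ω : Set (Rd d)) : Prop :=
  ∀ χ : Rd d → ℝ, ContDiff ℝ (⊤ : ℕ∞) χ → HasCompactSupport χ → (∀ x, 0 ≤ χ x) →
    tsupport χ ⊆ Ω → 0 ≤ ∫ x : Rd d, w x * lapRd χ x

theorem DistribSubharmonicOn.le_mollify {d : ℕ} {w : Rd d → ℝ} {Ω : Set (Rd d)}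
    (hw : DistribSubharmonicOn w Ω) (hwc : Continuous w) {M : ℝ} (hM : ∀ x, |w x| ≤ M)
    {x : Rd d} {r : ℝ} (hr : 0 < r) (hxr : Metric.closedBall x (2 * r) ⊆ Ω) :
    w x ≤ mollify r w x := by
  have h1 : Filter.Tendsto (fun δ => mollify δ w x) (nhdsWithin 0 (Set.Ioi 0))
      (nhds (w x)) := (tendsto_mollify hwc x).mono_left nhdsWithin_le_nhds
  have h2 : Filter.Tendsto (fun δ => mollify δ (mollify r w) x) (nhdsWithin 0 (Set.Ioi 0))
      (nhds (mollify r w x)) :=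
    (tendsto_mollify (continuous_mollify hwc r) x).mono_left nhdsWithin_le_nhds
  refine le_of_tendsto_of_tendsto h1 h2 ?_
  filter_upwards [Ioo_mem_nhdsGT hr] with δ hδ
  have h3 := le_mollify_sub_of_le_lapRd (contDiff_two_mollify hwc hδ.1.ne') (x := x) (A := 0)
    hr.le fun y hy => ?_
  · rw [mollify_comm hwc] at h3
    linarith
  · rw [lapRd_mollify hwc hM hδ.1]
    refine hw _ (contDiff_testKernel δ y) (hasCompactSupport_testKernel hδ.1 y)
      (testKernel_nonneg δ y) ((tsupport_testKernel_subset hδ.1 y).trans ?_)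
    refine (Metric.closedBall_subset_closedBall' ?_).trans hxr
    linarith [hδ.2, Metric.mem_closedBall.1 hy]

theorem DistribSubharmonicOn.eventually_eq_of_forall_le {d : ℕ} {w : Rd d → ℝ} {Ω : Set (Rd d)}
    (hw : DistribSubharmonicOn w Ω) (hwc : Continuous w) {M : ℝ} (hM : ∀ x, |w x| ≤ M)
    {x : Rd d} (hΩ : Ω ∈ nhds x) (hx : ∀ y, w y ≤ w x) : ∀ᶠ y in nhds x, w y = w x := by
  obtain ⟨ε, hε, hεΩ⟩ := Metric.nhds_basis_closedBall.mem_iff.1 hΩ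
  have hr : 0 < ε / 2 := half_pos hε
  have h1 := hw.le_mollify hwc hM hr (by rwa [mul_div_cancel₀ ε two_ne_zero])
  filter_upwards [Metric.ball_mem_nhds x hr] with y hy
  by_contra hne
  set z : Rd d := (ε / 2)⁻¹ • (x - y) with hz
  have hzy : x - (ε / 2) • z = y := by
    rw [hz, smul_smul, mul_inv_cancel₀ hr.ne', one_smul, sub_sub_cancel]
  have hz1 : ‖z‖ < 1 := by
    rw [hz, norm_smul, norm_inv, Real.norm_of_nonneg hr.le, inv_mul_eq_div, div_lt_one hr,
      ← dist_eq_norm, dist_comm]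
    exact hy
  have hc : Continuous fun z : Rd d => w x - w (x - (ε / 2) • z) := by fun_prop
  have h2 : 0 < ∫ z : Rd d, radialKernel z * (w x - w (x - (ε / 2) • z)) := by
    refine ((continuous_radialKernel d).mul
      hc).integral_pos_of_hasCompactSupport_nonneg_nonzero
      (hasCompactSupport_radialKernel d).mul_right
      (fun z => mul_nonneg (radialKernel_nonneg z) (sub_nonneg.2 (hx _))) (x := z) ?_
    simp only [hzy]
    exact mul_ne_zero (radialKernel_pos hz1).ne' (sub_ne_zero.2 (Ne.symm hne))
  have h3 := mollify_sub (u := fun _ => w x) continuous_const hwc (ε / 2) x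
  rw [mollify_const] at h3
  simp only [mollify] at h3 h1
  linarith

/-- The strong maximum principle for continuous distributionally subharmonic functions. -/
theorem DistribSubharmonicOn.eq_const_of_forall_le {d : ℕ} {w : Rd d → ℝ} {Ω : Set (Rd d)}
    (hw : DistribSubharmonicOn w Ω) (hwc : Continuous w) {M : ℝ} (hM : ∀ x, |w x| ≤ M)
    (hΩ : IsOpen Ω) {x₀ : Rd d} (hx₀ : ∀ y, w y ≤ w x₀) (hmem : ∀ y, w y = w x₀ → y ∈ Ω)
    (y : Rd d) : w y = w x₀ := by
  have hclopen : IsClopen {y | w y = w x₀} := by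
    refine ⟨isClosed_eq hwc continuous_const, isOpen_iff_mem_nhds.2 fun x hx => ?_⟩
    have hx' : w x = w x₀ := hx
    have := hw.eventually_eq_of_forall_le hwc hM (hΩ.mem_nhds (hmem x hx)) (hx' ▸ hx₀)
    rwa [hx'] at this
  exact Set.eq_univ_iff_forall.1 (hclopen.eq_univ ⟨x₀, rfl⟩) y

theorem DistribSubharmonicOn.eq_const_of_periodic {d : ℕ} {w : Rd d → ℝ}
    (hw : DistribSubharmonicOn w Set.univ) (hwc : Continuous w) (hwp : PeriodicRd w)
    (x y : Rd d) : w x = w y := by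
  obtain ⟨M, hM⟩ := hwp.exists_bound hwc
  obtain ⟨x₀, hx₀⟩ := hwp.exists_forall_le hwc
  have h := hw.eq_const_of_forall_le hwc hM isOpen_univ hx₀ fun _ _ => Set.mem_univ _
  rw [h x, h y]

theorem IsDOPSolution.le_of_sInf_le_sSup {d : ℕ} {φm φp u v : Rd d → ℝ}
    (hle : sInf (Set.range φp) ≤ sSup (Set.range φm))
    (hu : IsDOPSolution φm φp u) (hv : IsDOPSolution φm φp v) (x : Rd d) : u x ≤ v x := by
  obtain ⟨huc, hup, hub, husub, -⟩ := hu
  obtain ⟨hvc, hvp, hvb, -, hvsup⟩ := hv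
  by_contra! hlt
  have hwc : Continuous fun y => u y - v y := huc.sub hvc
  have hwp : PeriodicRd fun y => u y - v y := fun y j => by
    simp only [hup y j, hvp y j]
  obtain ⟨M, hM⟩ := hwp.exists_bound hwc
  obtain ⟨x₀, hx₀⟩ := hwp.exists_forall_le hwc
  have hpos : 0 < u x₀ - v x₀ := (sub_pos.2 hlt).trans_le (hx₀ x)
  have hsub : DistribSubharmonicOn (fun y => u y - v y) {y | v y < u y} := by
    intro χ hχ hχs hχ0 hsupp
    simp_rw [sub_mul]
    rw [integral_sub (integrable_mul_lapRd huc hχ hχs) (integrable_mul_lapRd hvc hχ hχs)]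
    have h1 := husub χ hχ hχs hχ0 fun y hy => (hvb y).1.trans_lt (hsupp hy)
    have h2 := hvsup χ hχ hχs hχ0 fun y hy => lt_of_lt_of_le (hsupp hy) (hub y).2
    linarith
  have hconst := hsub.eq_const_of_forall_le hwc hM (isOpen_lt hvc huc) hx₀ fun y hy => by
    have : u y - v y = u x₀ - v x₀ := hy
    show v y < u y
    linarith
  have hvu : ∀ y, v y < u y := fun y => by linarith [hconst y]
  have hu_univ : DistribSubharmonicOn u Set.univ := fun χ hχ hχs hχ0 _ =>
    husub χ hχ hχs hχ0 fun y _ => (hvb y).1.trans_lt (hvu y)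
  have hu_const := hu_univ.eq_const_of_periodic huc hup
  have h1 : sSup (Set.range φm) ≤ v x₀ := by
    refine csSup_le (Set.range_nonempty _) ?_
    rintro _ ⟨y, rfl⟩
    linarith [(hvb y).1, hconst y, hu_const y x₀]
  have h2 : u x₀ ≤ sInf (Set.range φp) := by
    refine le_csInf (Set.range_nonempty _) ?_
    rintro _ ⟨y, rfl⟩
    linarith [(hub y).2, hu_const y x₀]
  linarith

theorem integral_const_mul_lapRd {d : ℕ} (c : ℝ) {χ : Rd d → ℝ}
    (hχ : ContDiff ℝ (⊤ : ℕ∞) χ) (hχs : HasCompactSupport χ) :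
    ∫ x, c * lapRd χ x = 0 := by
  have h1 := tendsto_integral_mollify_sub_div_mul (u := fun _ => c) (U := fun _ _ => c)
    (M := |c|) (fun _ => continuous_const) (fun _ _ => le_rfl) (fun _ => tendsto_const_nhds)
    tendsto_scale scale_pos scale_le_one hχ hχs
  simp only [mollify_const, sub_self, zero_div, zero_mul, integral_zero] at h1
  have h2 := tendsto_nhds_unique h1 tendsto_const_nhds
  exact (mul_eq_zero.1 h2).resolve_left (by linarith [potentialMass_pos d])

theorem isDOPSolution_const {d : ℕ} {φm φp : Rd d → ℝ} {c : ℝ}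
    (h : ∀ x, φm x ≤ c ∧ c ≤ φp x) : IsDOPSolution φm φp fun _ => c :=
  ⟨continuous_const, fun _ _ => rfl, h,
    fun _ hχ hχs _ _ => (integral_const_mul_lapRd c hχ hχs).ge,
    fun _ hχ hχs _ _ => (integral_const_mul_lapRd c hχ hχs).le⟩

/-- The penalized discrete double obstacle problem at scale `h` is solvable. -/
theorem exists_discrete_solution {d : ℕ} {φm φp : Rd d → ℝ} (hm : Continuous φm)
    (hp : Continuous φp) {M δ : ℝ} (hmM : ∀ x, |φm x| ≤ M) (hpM : ∀ x, |φp x| ≤ M)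
    (hδ0 : 0 < δ) (hδ1 : δ < 1) (h : ℝ) :
    ∃ u : Rd d → ℝ, Continuous u ∧ (∀ x, |u x| ≤ M) ∧
      ∀ x, u x = max (φm x) (min (φp x) ((1 - δ) * mollify h u x)) := by
  have hbd : ∀ (c : ℝ) x, |max (φm x) (min (φp x) c)| ≤ M := fun c x =>
    abs_le.2 ⟨(abs_le.1 (hmM x)).1.trans (le_max_left _ _),
      max_le (abs_le.1 (hmM x)).2 ((min_le_left _ _).trans (abs_le.1 (hpM x)).2)⟩
  set T : BoundedContinuousFunction (Rd d) ℝ → BoundedContinuousFunction (Rd d) ℝ := fun f =>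
    BoundedContinuousFunction.ofNormedAddCommGroup
      (fun x => max (φm x) (min (φp x) ((1 - δ) * mollify h f x)))
      (hm.max (hp.min (continuous_const.mul (continuous_mollify f.continuous h)))) M
      (fun x => hbd _ x) with hT
  have hcontr : ContractingWith (1 - δ).toNNReal T := by
    refine ⟨Real.toNNReal_lt_one.2 (by linarith), LipschitzWith.of_dist_le_mul fun f g => ?_⟩
    rw [BoundedContinuousFunction.dist_le (by positivity), Real.coe_toNNReal _ (by linarith)]
    intro x
    have h1 : |mollify h f x - mollify h g x| ≤ dist f g := by
      rw [← mollify_sub f.continuous g.continuous]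
      exact abs_mollify_le (f.continuous.sub g.continuous) fun y _ =>
        BoundedContinuousFunction.dist_coe_le_dist (f := f) (g := g) y
    have h2 := abs_max_sub_max_le_max (φm x) (min (φp x) ((1 - δ) * mollify h f x)) (φm x)
      (min (φp x) ((1 - δ) * mollify h g x))
    have h3 := abs_min_sub_min_le_max (φp x) ((1 - δ) * mollify h f x) (φp x)
      ((1 - δ) * mollify h g x)
    have h4 : |(1 - δ) * mollify h f x - (1 - δ) * mollify h g x| ≤ (1 - δ) * dist f g := by
      rw [← mul_sub, abs_mul, abs_of_pos (by linarith)]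
      exact mul_le_mul_of_nonneg_left h1 (by linarith)
    rw [sub_self, abs_zero, max_eq_right (a := (0 : ℝ)) (abs_nonneg _)] at h2 h3
    exact (h2.trans h3).trans h4
  set u := hcontr.fixedPoint T
  have hfix : T u = u := hcontr.fixedPoint_isFixedPt
  have hval : ∀ x, u x = max (φm x) (min (φp x) ((1 - δ) * mollify h u x)) :=
    fun x => (DFunLike.congr_fun hfix x).symm
  exact ⟨u, u.continuous, fun x => by rw [hval x]; exact hbd _ x, hval⟩

theorem abs_discrete_shift_le {d : ℕ} {φm φp u : Rd d → ℝ} {M δ h B : ℝ} (hu : Continuous u)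
    (huM : ∀ x, |u x| ≤ M) (hδ0 : 0 < δ) (hδ1 : δ < 1)
    (heq : ∀ x, u x = max (φm x) (min (φp x) ((1 - δ) * mollify h u x))) {e : Rd d}
    (hm : ∀ x, |φm (x + e) - φm x| ≤ B) (hp : ∀ x, |φp (x + e) - φp x| ≤ B) (x : Rd d) :
    |u (x + e) - u x| ≤ B := by
  have hbdd : BddAbove (Set.range fun x => |u (x + e) - u x|) := by
    refine ⟨M + M, ?_⟩
    rintro _ ⟨x, rfl⟩
    exact (abs_sub _ _).trans (add_le_add (huM _) (huM _))
  set S := ⨆ x, |u (x + e) - u x| with hS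
  have hle : ∀ x, |u (x + e) - u x| ≤ S := fun x => le_ciSup hbdd x
  have hB : 0 ≤ B := (abs_nonneg _).trans (hm 0)
  have key : S ≤ max B ((1 - δ) * S) := by
    refine ciSup_le fun x => ?_
    have h1 : |mollify h u (x + e) - mollify h u x| ≤ S := by
      rw [← mollify_comp_add, ← mollify_sub (by fun_prop) hu]
      exact abs_mollify_le (by fun_prop) fun y _ => hle y
    have h2 := abs_max_sub_max_le_max (φm (x + e))
      (min (φp (x + e)) ((1 - δ) * mollify h u (x + e))) (φm x)
      (min (φp x) ((1 - δ) * mollify h u x))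
    have h3 := abs_min_sub_min_le_max (φp (x + e)) ((1 - δ) * mollify h u (x + e)) (φp x)
      ((1 - δ) * mollify h u x)
    have h4 : |(1 - δ) * mollify h u (x + e) - (1 - δ) * mollify h u x| ≤ (1 - δ) * S := by
      rw [← mul_sub, abs_mul, abs_of_pos (by linarith)]
      exact mul_le_mul_of_nonneg_left h1 (by linarith)
    rw [heq (x + e), heq x]
    refine h2.trans (max_le ((hm x).trans (le_max_left _ _)) (h3.trans ?_))
    exact max_le_max (hp x) h4
  refine (hle x).trans ?_
  rcases le_max_iff.1 key with h1 | h1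
  · exact h1
  · nlinarith

/-- Approximate subharmonicity off the lower contact set. -/
theorem discrete_lower_bound {d : ℕ} {φm φp u : Rd d → ℝ} {M δ h : ℝ} (hu : Continuous u)
    (huM : ∀ x, |u x| ≤ M) (hδ0 : 0 < δ)
    (heq : ∀ x, u x = max (φm x) (min (φp x) ((1 - δ) * mollify h u x))) {x : Rd d}
    (hx : φm x < u x) : -(δ * M) ≤ mollify h u x - u x := by
  have h1 : u x ≤ (1 - δ) * mollify h u x := by
    have := heq x
    rcases max_choice (φm x) (min (φp x) ((1 - δ) * mollify h u x)) with h | h <;>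
      rw [h] at this
    · exact absurd this hx.ne'
    · exact this.trans_le (min_le_right _ _)
  have h2 : |mollify h u x| ≤ M := abs_mollify_le hu fun y _ => huM y
  nlinarith [(abs_le.1 h2).1]

/-- Approximate superharmonicity off the upper contact set. -/
theorem discrete_upper_bound {d : ℕ} {φm φp u : Rd d → ℝ} {M δ h : ℝ} (hu : Continuous u)
    (huM : ∀ x, |u x| ≤ M) (hδ0 : 0 < δ)
    (heq : ∀ x, u x = max (φm x) (min (φp x) ((1 - δ) * mollify h u x))) {x : Rd d}
    (hx : u x < φp x) : mollify h u x - u x ≤ δ * M := by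
  have h1 : (1 - δ) * mollify h u x ≤ u x := by
    have h3 : min (φp x) ((1 - δ) * mollify h u x) ≤ u x := (le_max_right _ _).trans_eq (heq x).symm
    exact (min_le_iff.1 h3).resolve_left (not_le.2 hx)
  have h2 : |mollify h u x| ≤ M := abs_mollify_le hu fun y _ => huM y
  nlinarith [(abs_le.1 h2).2]

/-- Discrete Lewy–Stampacchia inequality. -/
theorem abs_discrete_laplacian_le {d : ℕ} {φm φp u : Rd d → ℝ} {M δ h Λ : ℝ}
    (hmreg : ContDiff ℝ 2 φm) (hpreg : ContDiff ℝ 2 φp) (hle : ∀ x, φm x ≤ φp x)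
    (hmΛ : ∀ x, |lapRd φm x| ≤ Λ) (hpΛ : ∀ x, |lapRd φp x| ≤ Λ) (hu : Continuous u)
    (huM : ∀ x, |u x| ≤ M) (hδ0 : 0 < δ) (hh : 0 ≤ h)
    (heq : ∀ x, u x = max (φm x) (min (φp x) ((1 - δ) * mollify h u x))) (x : Rd d) :
    |mollify h u x - u x| ≤ potentialMass d / 2 * h ^ 2 * Λ + δ * M := by
  have hum : ∀ x, φm x ≤ u x := fun x => (le_max_left _ _).trans_eq (heq x).symm
  have hup : ∀ x, u x ≤ φp x := fun x => by
    rw [heq x]; exact max_le (hle x) (min_le_left _ _)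
  have hM : 0 ≤ M := (abs_nonneg _).trans (huM x)
  have hΛ : 0 ≤ Λ := (abs_nonneg _).trans (hmΛ x)
  have hc := potentialMass_pos d
  have hpos : 0 ≤ potentialMass d / 2 * h ^ 2 * Λ := by positivity
  have hδM : 0 ≤ δ * M := by positivity
  refine abs_le.2 ⟨?_, ?_⟩
  · rcases (hum x).lt_or_eq with hx | hx
    · linarith [discrete_lower_bound hu huM hδ0 heq hx]
    · have h1 := abs_le.1 (abs_mollify_sub_le hmreg hh (x := x) fun y _ => hmΛ y)
      have h2 := mollify_mono (h := h) (x := x) hmreg.continuous hu fun y _ => hum y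
      linarith [h1.1]
  · rcases (hup x).lt_or_eq with hx | hx
    · linarith [discrete_upper_bound hu huM hδ0 heq hx]
    · have h1 := abs_le.1 (abs_mollify_sub_le hpreg hh (x := x) fun y _ => hpΛ y)
      have h2 := mollify_mono (h := h) (x := x) hu hpreg.continuous fun y _ => hup y
      linarith [h1.2]

theorem PeriodicRd.fderiv {d : ℕ} {f : Rd d → ℝ} (hf : PeriodicRd f) :
    PeriodicRd (fderiv ℝ f) := fun x j => by
  rw [← fderiv_comp_add_right]
  exact congrArg (fun g => _root_.fderiv ℝ g x) (funext fun y => hf y j)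

theorem PeriodicRd.lapRd {d : ℕ} {f : Rd d → ℝ} (hf : PeriodicRd f) :
    PeriodicRd (lapRd f) := fun x j => by
  refine Finset.sum_congr rfl fun i _ => ?_
  have h1 : PeriodicRd (fun y => _root_.fderiv ℝ f y (EuclideanSpace.single i (1 : ℝ))) :=
    fun y k => by simp only [hf.fderiv y k]
  rw [h1.fderiv x j]

theorem PeriodicRd.exists_lipschitz {d : ℕ} {f : Rd d → ℝ} (hf : PeriodicRd f)
    (hfc : ContDiff ℝ 1 f) : ∃ L, 0 ≤ L ∧ ∀ x y, |f y - f x| ≤ L * ‖y - x‖ := by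
  obtain ⟨L, hL⟩ := hf.fderiv.exists_bound (hfc.continuous_fderiv (by norm_num))
  refine ⟨L, (norm_nonneg _).trans (hL 0), fun x y => ?_⟩
  exact convex_univ.norm_image_sub_le_of_norm_fderiv_le
    (fun z _ => (hfc.differentiable (by norm_num)).differentiableAt) (fun z _ => hL z)
    (Set.mem_univ x) (Set.mem_univ y)

/-- An equibounded, equi-Lipschitz sequence of periodic functions has a uniformly convergent
subsequence. -/
theorem exists_subseq_tendstoUniformly {d : ℕ} {U : ℕ → Rd d → ℝ} {M L : ℝ}
    (hper : ∀ n, PeriodicRd (U n)) (hM : ∀ n x, |U n x| ≤ M)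
    (hL : ∀ n x y, |U n y - U n x| ≤ L * ‖y - x‖) :
    ∃ (u : Rd d → ℝ) (k : ℕ → ℕ), StrictMono k ∧
      TendstoUniformly (fun n => U (k n)) u Filter.atTop := by
  have hUc : ∀ n, Continuous (U n) := fun n =>
    (LipschitzWith.of_dist_le' (K := L) fun x y => by
      rw [Real.dist_eq, dist_eq_norm]; exact hL n y x).continuous
  set K := Metric.closedBall (0 : Rd d) (√(d * (2 * π) ^ 2))
  have : CompactSpace K := isCompact_iff_compactSpace.1 (isCompact_closedBall _ _)
  set F : ℕ → BoundedContinuousFunction K ℝ := fun n =>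
    BoundedContinuousFunction.ofNormedAddCommGroup (fun x => U n x)
      ((hUc n).comp continuous_subtype_val) M (fun x => hM n x)
  have hcpt : IsCompact (closure (Set.range F)) := by
    refine BoundedContinuousFunction.arzela_ascoli (Set.Icc (-M) M) isCompact_Icc _ ?_ ?_
    · rintro _ x ⟨n, rfl⟩
      exact abs_le.1 (hM n x)
    · refine Metric.equicontinuous_of_continuity_modulus (fun t => L * t) ?_ _ ?_
      · simpa using (continuous_const_mul L).tendsto 0
      · rintro x y ⟨_, n, rfl⟩
        rw [Real.dist_eq, Subtype.dist_eq, dist_eq_norm]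
        exact hL n y x
  obtain ⟨g, -, k, hk, hg⟩ := hcpt.tendsto_subseq fun n => subset_closure (Set.mem_range_self n)
  rw [BoundedContinuousFunction.tendsto_iff_tendstoUniformly] at hg
  have hy : ∀ x, ∃ y ∈ K, (fun n => U n y) = fun n => U n x :=
    PeriodicRd.exists_mem_closedBall (f := fun x n => U n x) fun x j =>
      funext fun n => hper n x j
  choose y hyK hyU using hy
  refine ⟨fun x => g ⟨y x, hyK x⟩, k, hk, ?_⟩
  convert hg.comp fun x => (⟨y x, hyK x⟩ : K) using 1
  · exact funext fun n => funext fun x => (congrFun (hyU x) (k n)).symm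
  · rfl

theorem mul_integral_le_of_le_discrete_laplacian {d : ℕ} {u : Rd d → ℝ} {U : ℕ → Rd d → ℝ}
    {h c : ℕ → ℝ} {M c₀ : ℝ} (hU : ∀ n, Continuous (U n)) (hUM : ∀ n x, |U n x| ≤ M)
    (hUu : ∀ x, Filter.Tendsto (fun n => U n x) Filter.atTop (nhds (u x)))
    (hh : Filter.Tendsto h Filter.atTop (nhdsWithin 0 (Set.Ioi 0)))
    (hh0 : ∀ n, 0 < h n) (hh1 : ∀ n, h n ≤ 1) (hc : Filter.Tendsto c Filter.atTop (nhds c₀))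
    {χ : Rd d → ℝ} (hχ : ContDiff ℝ (⊤ : ℕ∞) χ) (hχs : HasCompactSupport χ) (hχ0 : ∀ x, 0 ≤ χ x)
    (hlow : ∀ᶠ n in Filter.atTop, ∀ x ∈ tsupport χ,
      c n ≤ (mollify (h n) (U n) x - U n x) / h n ^ 2) :
    c₀ * ∫ x, χ x ≤ potentialMass d / 2 * ∫ x, u x * lapRd χ x := by
  refine le_of_tendsto_of_tendsto (hc.mul_const _)
    (tendsto_integral_mollify_sub_div_mul hU hUM hUu hh hh0 hh1 hχ hχs) ?_
  filter_upwards [hlow] with n hn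
  have hχc := hχ.continuous
  rw [← integral_const_mul]
  refine integral_mono ((continuous_const.mul hχc).integrable_of_hasCompactSupport hχs.mul_left)
    ((Continuous.mul ?_ hχc).integrable_of_hasCompactSupport hχs.mul_left) fun x => ?_
  · exact ((continuous_mollify (hU n) _).sub (hU n)).div_const _
  · by_cases hx : x ∈ tsupport χ
    · exact mul_le_mul_of_nonneg_right (hn x hx) (hχ0 x)
    · simp [image_eq_zero_of_notMem_tsupport hx]

theorem le_mul_integral_of_discrete_laplacian_le {d : ℕ} {u : Rd d → ℝ} {U : ℕ → Rd d → ℝ}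
    {h c : ℕ → ℝ} {M c₀ : ℝ} (hU : ∀ n, Continuous (U n)) (hUM : ∀ n x, |U n x| ≤ M)
    (hUu : ∀ x, Filter.Tendsto (fun n => U n x) Filter.atTop (nhds (u x)))
    (hh : Filter.Tendsto h Filter.atTop (nhdsWithin 0 (Set.Ioi 0)))
    (hh0 : ∀ n, 0 < h n) (hh1 : ∀ n, h n ≤ 1) (hc : Filter.Tendsto c Filter.atTop (nhds c₀))
    {χ : Rd d → ℝ} (hχ : ContDiff ℝ (⊤ : ℕ∞) χ) (hχs : HasCompactSupport χ) (hχ0 : ∀ x, 0 ≤ χ x)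
    (hup : ∀ᶠ n in Filter.atTop, ∀ x ∈ tsupport χ,
      (mollify (h n) (U n) x - U n x) / h n ^ 2 ≤ c n) :
    potentialMass d / 2 * ∫ x, u x * lapRd χ x ≤ c₀ * ∫ x, χ x := by
  have hmol : ∀ n x, mollify (h n) (fun y => -U n y) x = -mollify (h n) (U n) x := fun n x => by
    simpa using mollify_const_mul (U n) (-1) (h n) x
  have := mul_integral_le_of_le_discrete_laplacian (u := fun x => -u x) (U := fun n x => -U n x)
    (c := fun n => -c n) (fun n => (hU n).neg) (fun n x => by simpa using hUM n x)
    (fun x => (hUu x).neg) hh hh0 hh1 hc.neg hχ hχs hχ0 <| by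
      filter_upwards [hup] with n hn x hx
      rw [hmol, ← neg_sub', neg_div]
      exact neg_le_neg (hn x hx)
  simp only [neg_mul, integral_neg, mul_neg] at this
  exact neg_le_neg_iff.1 this

theorem eventually_forall_mem_lt_of_isCompact {d : ℕ} {φ u : Rd d → ℝ} {U : ℕ → Rd d → ℝ}
    (hφ : Continuous φ) (hu : Continuous u) (hUu : TendstoUniformly U u Filter.atTop)
    {K : Set (Rd d)} (hK : IsCompact K) (hKu : K ⊆ {x | φ x < u x}) :
    ∀ᶠ n in Filter.atTop, ∀ x ∈ K, φ x < U n x := by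
  rcases K.eq_empty_or_nonempty with rfl | hne
  · simp
  obtain ⟨x₀, hx₀, hmin⟩ := hK.exists_isMinOn hne (hu.sub hφ).continuousOn
  filter_upwards [Metric.tendstoUniformly_iff.1 hUu (u x₀ - φ x₀) (sub_pos.2 (hKu hx₀))]
    with n hn x hx
  have h1 : u x₀ - φ x₀ ≤ u x - φ x := hmin hx
  have h2 := (abs_lt.1 (hn x)).2
  linarith

/-- The double obstacle problem has a solution with bounded distributional Laplacian. -/
theorem exists_isDOPSolution_bounded_laplacian {d : ℕ} {φm φp : Rd d → ℝ}
    (hmreg : ContDiff ℝ 2 φm) (hpreg : ContDiff ℝ 2 φp)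
    (hmper : PeriodicRd φm) (hpper : PeriodicRd φp) (hle : ∀ x, φm x ≤ φp x) :
    ∃ (u : Rd d → ℝ) (Λ : ℝ), IsDOPSolution φm φp u ∧
      ∀ δ > 0, ∀ x, |lapRd (mollify δ u) x| ≤ Λ := by
  obtain ⟨Mm, hMm⟩ := hmper.exists_bound hmreg.continuous
  obtain ⟨Mp, hMp⟩ := hpper.exists_bound hpreg.continuous
  obtain ⟨Λm, hΛm⟩ := hmper.lapRd.exists_bound (continuous_lapRd hmreg)
  obtain ⟨Λp, hΛp⟩ := hpper.lapRd.exists_bound (continuous_lapRd hpreg)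
  obtain ⟨Lm, hLm0, hLm⟩ := hmper.exists_lipschitz (hmreg.of_le (by norm_num))
  obtain ⟨Lp, hLp0, hLp⟩ := hpper.exists_lipschitz (hpreg.of_le (by norm_num))
  set M := max Mm Mp
  set Λ := max Λm Λp
  set L := max Lm Lp
  have hδ0 : ∀ n, 0 < scale n ^ 3 / 2 := fun n => by have := scale_pos n; positivity
  have hδ1 : ∀ n, scale n ^ 3 / 2 < 1 := fun n => by
    have := pow_le_one₀ (n := 3) (scale_pos n).le (scale_le_one n)
    linarith
  choose U hUc hUM hUeq using fun n => exists_discrete_solution hmreg.continuous hpreg.continuous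
    (fun x => (hMm x).trans (le_max_left Mm Mp)) (fun x => (hMp x).trans (le_max_right Mm Mp))
    (hδ0 n) (hδ1 n) (scale n)
  have hM0 : 0 ≤ M := (abs_nonneg _).trans (hUM 0 0)
  have hUper : ∀ n, PeriodicRd (U n) := fun n x j => by
    have := abs_discrete_shift_le (B := 0) (hUc n) (hUM n) (hδ0 n) (hδ1 n) (hUeq n)
      (fun x => by rw [hmper x j]; simp) (fun x => by rw [hpper x j]; simp) x
    exact sub_eq_zero.1 (abs_nonpos_iff.1 this)
  have hUL : ∀ n x y, |U n y - U n x| ≤ L * ‖y - x‖ := fun n x y => by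
    have := abs_discrete_shift_le (B := L * ‖y - x‖) (e := y - x) (hUc n) (hUM n) (hδ0 n) (hδ1 n)
      (hUeq n)
      (fun z => (hLm z (z + (y - x))).trans <| by
        rw [add_sub_cancel_left]
        exact mul_le_mul_of_nonneg_right (le_max_left _ _) (norm_nonneg _))
      (fun z => (hLp z (z + (y - x))).trans <| by
        rw [add_sub_cancel_left]
        exact mul_le_mul_of_nonneg_right (le_max_right _ _) (norm_nonneg _)) x
    rwa [add_sub_cancel] at this
  have hδh : ∀ n, scale n ^ 3 / 2 * M = scale n / 2 * M * scale n ^ 2 := fun n => by ring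
  have hlow : ∀ n x, φm x < U n x →
      -(scale n / 2 * M) ≤ (mollify (scale n) (U n) x - U n x) / scale n ^ 2 := fun n x hx => by
    rw [le_div_iff₀ (pow_pos (scale_pos n) 2), neg_mul, ← hδh]
    exact discrete_lower_bound (hUc n) (hUM n) (hδ0 n) (hUeq n) hx
  have hupp : ∀ n x, U n x < φp x →
      (mollify (scale n) (U n) x - U n x) / scale n ^ 2 ≤ scale n / 2 * M := fun n x hx => by
    rw [div_le_iff₀ (pow_pos (scale_pos n) 2), ← hδh]
    exact discrete_upper_bound (hUc n) (hUM n) (hδ0 n) (hUeq n) hx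
  have hbd : ∀ n x, |(mollify (scale n) (U n) x - U n x) / scale n ^ 2| ≤
      potentialMass d / 2 * Λ + M := fun n x => by
    have hs := scale_pos n
    rw [abs_div, abs_of_pos (pow_pos hs 2), div_le_iff₀ (pow_pos hs 2)]
    refine (abs_discrete_laplacian_le hmreg hpreg hle (fun x => (hΛm x).trans (le_max_left Λm Λp))
      (fun x => (hΛp x).trans (le_max_right Λm Λp)) (hUc n) (hUM n) (hδ0 n) hs.le
      (hUeq n) x).trans ?_
    rw [hδh]
    have h1 : scale n / 2 * M ≤ M := by nlinarith [scale_le_one n]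
    nlinarith [mul_le_mul_of_nonneg_right h1 (sq_nonneg (scale n))]
  obtain ⟨u, k, hk, hku⟩ := exists_subseq_tendstoUniformly hUper hUM hUL
  have huc : Continuous u := hku.continuous (Filter.Frequently.of_forall fun n => hUc (k n))
  have hpt : ∀ x, Filter.Tendsto (fun n => U (k n) x) Filter.atTop (nhds (u x)) :=
    fun x => hku.tendsto_at x
  have hsc : Filter.Tendsto (fun n => scale (k n)) Filter.atTop (nhdsWithin 0 (Set.Ioi 0)) :=
    tendsto_scale.comp hk.tendsto_atTop
  have hzero : Filter.Tendsto (fun n => scale (k n) / 2 * M) Filter.atTop (nhds 0) := by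
    simpa using ((hsc.mono_right nhdsWithin_le_nhds).div_const 2).mul_const M
  have hpm := potentialMass_pos d
  have huM : ∀ x, |u x| ≤ M := fun x =>
    le_of_tendsto (hpt x).abs (Filter.Eventually.of_forall fun n => hUM (k n) x)
  have hχpos : 0 < potentialMass d / 2 := by positivity
  refine ⟨u, (potentialMass d / 2 * Λ + M) / (potentialMass d / 2),
    ⟨huc, fun x j => ?_, fun x => ⟨?_, ?_⟩, fun χ hχ hχs hχ0 hsub => ?_,
      fun χ hχ hχs hχ0 hsub => ?_⟩, fun δ hδ x => ?_⟩
  · refine tendsto_nhds_unique (hpt _) ((hpt x).congr fun n => ?_)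
    exact (hUper (k n) x j).symm
  · refine ge_of_tendsto (hpt x) (Filter.Eventually.of_forall fun n => ?_)
    exact (le_max_left _ _).trans_eq (hUeq (k n) x).symm
  · refine le_of_tendsto (hpt x) (Filter.Eventually.of_forall fun n => ?_)
    rw [hUeq (k n) x]
    exact max_le (hle x) (min_le_left _ _)
  · have h1 := mul_integral_le_of_le_discrete_laplacian (fun n => hUc (k n)) (fun n => hUM (k n))
      hpt hsc (fun n => scale_pos _) (fun n => scale_le_one _) hzero.neg hχ hχs hχ0 <| by
        filter_upwards [eventually_forall_mem_lt_of_isCompact hmreg.continuous huc hku hχs hsub]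
          with n hn x hx
        exact hlow (k n) x (hn x hx)
    rw [neg_zero, zero_mul] at h1
    exact nonneg_of_mul_nonneg_right h1 hχpos
  · have hneg : TendstoUniformly (fun n x => -U (k n) x) (fun x => -u x) Filter.atTop := hku.neg
    have h1 := le_mul_integral_of_discrete_laplacian_le (fun n => hUc (k n)) (fun n => hUM (k n))
      hpt hsc (fun n => scale_pos _) (fun n => scale_le_one _) hzero hχ hχs hχ0 <| by
        filter_upwards [eventually_forall_mem_lt_of_isCompact hpreg.continuous.neg huc.neg hneg hχs
          (fun x hx => Set.mem_ofPred.2 (neg_lt_neg (Set.mem_ofPred.1 (hsub hx))))] with n hn x hx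
        exact hupp (k n) x (neg_lt_neg_iff.1 (hn x hx))
    rw [zero_mul] at h1
    exact nonpos_of_mul_nonpos_right h1 hχpos
  · have h1 := mul_integral_le_of_le_discrete_laplacian (fun n => hUc (k n)) (fun n => hUM (k n))
      hpt hsc (fun n => scale_pos _) (fun n => scale_le_one _)
      (tendsto_const_nhds (x := -(potentialMass d / 2 * Λ + M))) (contDiff_testKernel δ x)
      (hasCompactSupport_testKernel hδ x) (testKernel_nonneg δ x)
      (Filter.Eventually.of_forall fun n y _ => (abs_le.1 (hbd (k n) y)).1)
    have h2 := le_mul_integral_of_discrete_laplacian_le (fun n => hUc (k n)) (fun n => hUM (k n))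
      hpt hsc (fun n => scale_pos _) (fun n => scale_le_one _)
      (tendsto_const_nhds (x := potentialMass d / 2 * Λ + M)) (contDiff_testKernel δ x)
      (hasCompactSupport_testKernel hδ x) (testKernel_nonneg δ x)
      (Filter.Eventually.of_forall fun n y _ => (abs_le.1 (hbd (k n) y)).2)
    rw [integral_testKernel hδ, mul_one, ← lapRd_mollify huc huM hδ] at h1 h2
    rw [le_div_iff₀ hχpos, ← abs_of_pos hχpos, ← abs_mul, abs_of_pos hχpos, mul_comm]
    exact abs_le.2 ⟨h1, h2⟩

open scoped Convolution in
theorem norm_convolution_le {d : ℕ} {E F : Type*} [NormedAddCommGroup E] [NormedSpace ℝ E]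
    [NormedAddCommGroup F] [NormedSpace ℝ F] (L : ℝ →L[ℝ] E →L[ℝ] F) (hL : ‖L‖ ≤ 1)
    {g : Rd d → ℝ} {q : ℝ} (hg : ∀ x, |g x| ≤ q) {k : Rd d → E} (hk : Integrable k) (x : Rd d) :
    ‖(g ⋆[L, volume] k) x‖ ≤ q * ∫ y, ‖k y‖ := by
  rw [convolution_def, ← integral_sub_left_eq_self (fun y => ‖k y‖) volume x,
    ← integral_const_mul]
  refine norm_integral_le_of_norm_le ((hk.norm.comp_sub_left x).const_mul q)
    (Filter.Eventually.of_forall fun t => ?_)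
  refine (L.le_opNorm₂ _ _).trans ?_
  have h1 : ‖L‖ * ‖g t‖ ≤ 1 * q := mul_le_mul hL (hg t) (norm_nonneg _) zero_le_one
  rw [one_mul] at h1
  exact mul_le_mul_of_nonneg_right h1 (norm_nonneg _)

open scoped Convolution in
theorem norm_convolution_sub_le {d : ℕ} {E F : Type*} [NormedAddCommGroup E] [NormedSpace ℝ E]
    [NormedAddCommGroup F] [NormedSpace ℝ F] (L : ℝ →L[ℝ] E →L[ℝ] F) (hL : ‖L‖ ≤ 1)
    {g : Rd d → ℝ} (hgc : Continuous g) {q : ℝ} (hg : ∀ x, |g x| ≤ q) {k : Rd d → E}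
    (hk : ContDiff ℝ 1 k) (hks : HasCompactSupport k) (x y : Rd d) :
    ‖(g ⋆[L, volume] k) y - (g ⋆[L, volume] k) x‖ ≤ q * (∫ z, ‖fderiv ℝ k z‖) * ‖y - x‖ :=
  convex_univ.norm_image_sub_le_of_norm_hasFDerivWithin_le
    (fun z _ => (hks.hasFDerivAt_convolution_right L
      hgc.locallyIntegrable hk z).hasFDerivWithinAt)
    (fun z _ => norm_convolution_le _ ((L.norm_precompR_le (Rd d)).trans hL) hg
      ((hk.continuous_fderiv (by norm_num)).integrable_of_hasCompactSupport (hks.fderiv ℝ)) z)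
    (Set.mem_univ x) (Set.mem_univ y)

/-- First and second derivative bounds for averages of a bounded function. -/
theorem exists_mollify_fderiv_bound (d : ℕ) : ∃ C, 0 ≤ C ∧ ∀ (w : Rd d → ℝ) (q s : ℝ),
    Continuous w → (∀ x, |w x| ≤ q) → 0 < s →
      (∀ x, ‖fderiv ℝ (mollify s w) x‖ ≤ C * q / s) ∧
        ∀ x y, ‖fderiv ℝ (mollify s w) y - fderiv ℝ (mollify s w) x‖ ≤
          C * q / s ^ 2 * ‖y - x‖ := by
  have hρ : ContDiff ℝ 2 (radialKernel (d := d)) := by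
    exact_mod_cast contDiff_infty.1 (contDiff_radialKernel d) 2
  have hρs := hasCompactSupport_radialKernel d
  have hρ' : ContDiff ℝ 1 (fderiv ℝ (radialKernel (d := d))) :=
    hρ.fderiv_right (m := 1) (by norm_num)
  have hi1 : Integrable (fderiv ℝ (radialKernel (d := d))) :=
    hρ'.continuous.integrable_of_hasCompactSupport (hρs.fderiv ℝ)
  set A := ∫ y, ‖fderiv ℝ (radialKernel (d := d)) y‖
  set B := ∫ y, ‖fderiv ℝ (fderiv ℝ (radialKernel (d := d))) y‖
  have hA : 0 ≤ A := integral_nonneg fun _ => norm_nonneg _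
  have hB : 0 ≤ B := integral_nonneg fun x => norm_nonneg (fderiv ℝ (fderiv ℝ radialKernel) x)
  refine ⟨A + B, by positivity, fun w q s hw hwq hs => ?_⟩
  have hq : 0 ≤ q := (abs_nonneg _).trans (hwq 0)
  set g : Rd d → ℝ := fun y => w (s • y) with hg
  have hgc : Continuous g := by fun_prop
  set L : ℝ →L[ℝ] ℝ →L[ℝ] ℝ := ContinuousLinearMap.lsmul ℝ ℝ
  have hL : ‖L‖ ≤ 1 := ContinuousLinearMap.opNorm_lsmul_le
  have hL1 := (L.norm_precompR_le (Rd d)).trans hL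
  set G' := convolution g (fderiv ℝ (radialKernel (d := d))) (L.precompR (Rd d)) volume
  have hG1 : ∀ x, HasFDerivAt (convolution g radialKernel L volume) (G' x) x :=
    hρs.hasFDerivAt_convolution_right L hgc.locallyIntegrable (hρ.of_le (by norm_num))
  have hfd : ∀ x, fderiv ℝ (mollify s w) x = s⁻¹ • G' (s⁻¹ • x) := fun x => by
    rw [funext (mollify_eq_convolution w hs.ne')]
    change fderiv ℝ (fun x => convolution g radialKernel L volume (s⁻¹ • x)) x = _
    rw [fderiv_comp_smul, (hG1 _).fderiv]
  have hG'bd : ∀ x, ‖G' x‖ ≤ q * A :=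
    norm_convolution_le _ hL1 (fun x => hwq _) hi1
  have hG'lip : ∀ x y, ‖G' y - G' x‖ ≤ q * B * ‖y - x‖ :=
    norm_convolution_sub_le _ hL1 hgc (fun x => hwq _) hρ' (hρs.fderiv ℝ)
  have hsi : ‖s⁻¹‖ = s⁻¹ := Real.norm_of_nonneg (by positivity)
  refine ⟨fun x => ?_, fun x y => ?_⟩
  · rw [hfd, norm_smul, hsi, div_eq_inv_mul]
    refine mul_le_mul_of_nonneg_left ((hG'bd _).trans ?_) (by positivity)
    nlinarith
  · rw [hfd, hfd, ← smul_sub, norm_smul, hsi]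
    have h1 := hG'lip (s⁻¹ • x) (s⁻¹ • y)
    rw [← smul_sub, norm_smul, hsi] at h1
    calc s⁻¹ * ‖G' (s⁻¹ • y) - G' (s⁻¹ • x)‖ ≤ s⁻¹ * (q * B * (s⁻¹ * ‖y - x‖)) :=
          mul_le_mul_of_nonneg_left h1 (by positivity)
      _ = (s⁻¹ ^ 2 * ‖y - x‖) * (q * B) := by ring
      _ ≤ (s⁻¹ ^ 2 * ‖y - x‖) * ((A + B) * q) :=
          mul_le_mul_of_nonneg_left (by nlinarith) (by positivity)
      _ = (A + B) * q / s ^ 2 * ‖y - x‖ := by field_simp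

theorem abs_mollify_sub_self_le_of_bounded_laplacian {d : ℕ} {u : Rd d → ℝ} (hu : Continuous u)
    {Λ : ℝ} (hΛ : ∀ δ > 0, ∀ x, |lapRd (mollify δ u) x| ≤ Λ) {t : ℝ} (ht : 0 ≤ t) (x : Rd d) :
    |mollify t u x - u x| ≤ potentialMass d / 2 * t ^ 2 * Λ := by
  have h1 : Filter.Tendsto (fun δ => |mollify δ (mollify t u) x - mollify δ u x|)
      (nhdsWithin 0 (Set.Ioi 0)) (nhds |mollify t u x - u x|) :=
    (((tendsto_mollify (continuous_mollify hu t) x).sub (tendsto_mollify hu x)).abs).mono_left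
      nhdsWithin_le_nhds
  refine le_of_tendsto h1 ?_
  filter_upwards [self_mem_nhdsWithin] with δ hδ
  rw [mollify_comm hu]
  exact abs_mollify_sub_le (contDiff_two_mollify hu (ne_of_gt hδ)) ht fun y _ => hΛ δ hδ y

theorem le_rpow_mul_rpow_of_le_of_le {X P Q a : ℝ} (hX : 0 ≤ X) (hXP : X ≤ P) (hXQ : X ≤ Q)
    (ha0 : 0 < a)
    (ha1 : a < 1) : X ≤ P ^ (1 - a) * Q ^ a := by
  calc X = X ^ (1 - a) * X ^ a := by
        rw [← Real.rpow_add' hX (by simp), sub_add_cancel, Real.rpow_one]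
    _ ≤ P ^ (1 - a) * Q ^ a := by
        have := hX.trans hXP
        gcongr

/-- A function given by a dyadic series with geometric gradients and equi-Lipschitz gradients
is `C^{1,a}` for every `a < 1`. -/
theorem contDiff_and_holderWith_of_dyadic {d : ℕ} {u : Rd d → ℝ} {F : ℕ → Rd d → ℝ} {A : ℝ}
    (hF : ∀ n, ContDiff ℝ 1 (F n)) (hF1 : ∀ n x, ‖fderiv ℝ (F n) x‖ ≤ A * (1 / 2) ^ n)
    (hF2 : ∀ n x y, ‖fderiv ℝ (F n) y - fderiv ℝ (F n) x‖ ≤ A * ‖y - x‖)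
    (hsum : ∀ x, HasSum (fun n => F n x) (u x)) :
    ContDiff ℝ 1 u ∧
      ∀ a : NNReal, 0 < a → a < 1 → ∃ C : NNReal, HolderWith C a (fderiv ℝ u) := by
  have hA : 0 ≤ A := by simpa using (norm_nonneg _).trans (hF1 0 0)
  have hgeo : Summable fun n : ℕ => A * (1 / 2 : ℝ) ^ n := summable_geometric_two.mul_left A
  have hu : u = fun x => ∑' n, F n x := funext fun x => (hsum x).tsum_eq.symm
  have hfd : ∀ x, HasFDerivAt u (∑' n, fderiv ℝ (F n) x) x := fun x => by
    rw [hu]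
    exact hasFDerivAt_tsum hgeo
      (fun n y => ((hF n).differentiable (by norm_num) y).hasFDerivAt) hF1 (hsum 0).summable x
  have hfd' : fderiv ℝ u = fun x => ∑' n, fderiv ℝ (F n) x := funext fun x => (hfd x).fderiv
  have hs : ∀ x, Summable fun n => fderiv ℝ (F n) x := fun x =>
    Summable.of_norm_bounded hgeo fun n => hF1 n x
  refine ⟨contDiff_one_iff_fderiv.2 ⟨fun x => (hfd x).differentiableAt, ?_⟩, fun a ha0 ha1 => ?_⟩
  · rw [hfd']
    exact continuous_tsum (fun n => (hF n).continuous_fderiv (by norm_num)) hgeo hF1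
  · have ha0' : (0 : ℝ) < a := ha0
    have ha1' : (a : ℝ) < 1 := ha1
    set r : ℝ := (1 / 2 : ℝ) ^ (1 - (a : ℝ)) with hr
    have hr0 : 0 ≤ r := by positivity
    have hr1 : r < 1 := Real.rpow_lt_one (by norm_num) (by norm_num) (by linarith)
    have hrs : HasSum (fun n : ℕ => r ^ n) (1 - r)⁻¹ := hasSum_geometric_of_lt_one hr0 hr1
    have hC : 0 ≤ 2 * A * (1 - r)⁻¹ :=
      mul_nonneg (by positivity) (inv_nonneg.2 (by linarith))
    have key : ∀ x y, ‖fderiv ℝ u y - fderiv ℝ u x‖ ≤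
        2 * A * (1 - r)⁻¹ * ‖y - x‖ ^ (a : ℝ) := fun x y => by
      rw [hfd']
      change ‖(∑' n, fderiv ℝ (F n) y) - ∑' n, fderiv ℝ (F n) x‖ ≤ _
      rw [← (hs y).tsum_sub (hs x)]
      have hsum' := (hrs.mul_left (2 * A)).mul_right (‖y - x‖ ^ (a : ℝ))
      refine tsum_of_norm_bounded hsum' fun n => ?_
      have h1 : ‖fderiv ℝ (F n) y - fderiv ℝ (F n) x‖ ≤ 2 * A * (1 / 2) ^ n :=
        (norm_sub_le _ _).trans (by linarith [hF1 n x, hF1 n y])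
      have h2 : ‖fderiv ℝ (F n) y - fderiv ℝ (F n) x‖ ≤ 2 * A * ‖y - x‖ :=
        (hF2 n x y).trans (by nlinarith [norm_nonneg (y - x)])
      refine (le_rpow_mul_rpow_of_le_of_le (norm_nonneg _) h1 h2 ha0' ha1').trans_eq ?_
      rw [Real.mul_rpow (x := 2 * A) (by positivity) (by positivity),
        Real.mul_rpow (x := 2 * A) (by positivity) (norm_nonneg _), hr,
        ← Real.rpow_natCast, ← Real.rpow_natCast, ← Real.rpow_mul
        (by norm_num), ← Real.rpow_mul (by norm_num), mul_comm (n : ℝ)]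
      have h3 : (2 * A) ^ (1 - (a : ℝ)) * (2 * A) ^ (a : ℝ) = 2 * A := by
        rw [← Real.rpow_add' (by positivity) (by simp), sub_add_cancel, Real.rpow_one]
      rw [mul_mul_mul_comm, h3]
      ring
    refine ⟨(2 * A * (1 - r)⁻¹).toNNReal, fun x y => ?_⟩
    rw [edist_dist, edist_dist, dist_eq_norm, dist_eq_norm,
      ENNReal.ofReal_rpow_of_nonneg (norm_nonneg _) ha0'.le, ← ENNReal.ofReal,
      ← ENNReal.ofReal_mul hC]
    exact ENNReal.ofReal_le_ofReal (key y x)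

/-- Twofold averages of `u` at dyadic scales, preceded by the zero function. -/
def dyadicAverage {d : ℕ} (u : Rd d → ℝ) : ℕ → Rd d → ℝ
  | 0 => fun _ => 0
  | n + 1 => mollify ((1 / 2) ^ n) (mollify ((1 / 2) ^ n) u)

theorem tendsto_dyadicAverage {d : ℕ} {u : Rd d → ℝ} (hu : Continuous u) {C : ℝ}
    (hC : ∀ t ≥ 0, ∀ x, |mollify t u x - u x| ≤ C * t ^ 2) (x : Rd d) :
    Filter.Tendsto (fun n => dyadicAverage u n x) Filter.atTop (nhds (u x)) := by
  rw [← Filter.tendsto_add_atTop_iff_nat 1]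
  have h0 : Filter.Tendsto (fun n : ℕ => ((1 / 2 : ℝ) ^ n)) Filter.atTop (nhds 0) :=
    tendsto_pow_atTop_nhds_zero_of_lt_one (by norm_num) (by norm_num)
  have h1 : Filter.Tendsto (fun n : ℕ => 2 * (C * ((1 / 2 : ℝ) ^ n) ^ 2)) Filter.atTop
      (nhds 0) := by
    simpa using ((h0.pow 2).const_mul C).const_mul 2
  refine tendsto_iff_norm_sub_tendsto_zero.2
    (squeeze_zero (fun n => norm_nonneg _) (fun n => ?_) h1)
  set t : ℝ := (1 / 2) ^ n
  have ht : 0 ≤ t := by positivity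
  have h2 : |mollify t (mollify t u) x - mollify t u x| ≤ C * t ^ 2 := by
    rw [← mollify_sub (continuous_mollify hu t) hu]
    exact abs_mollify_le ((continuous_mollify hu t).sub hu) fun y _ => hC t ht y
  change |mollify t (mollify t u) x - u x| ≤ _
  linarith [abs_sub_le (mollify t (mollify t u) x) (mollify t u x) (u x), hC t ht x]

theorem contDiff_and_holderWith_of_mollify_sub_le {d : ℕ} {u : Rd d → ℝ} (hu : Continuous u)
    {M C : ℝ} (hM : ∀ x, |u x| ≤ M) (hC : ∀ t ≥ 0, ∀ x, |mollify t u x - u x| ≤ C * t ^ 2) :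
    ContDiff ℝ 1 u ∧
      ∀ a : NNReal, 0 < a → a < 1 → ∃ C : NNReal, HolderWith C a (fderiv ℝ u) := by
  obtain ⟨B, hB0, hB⟩ := exists_mollify_fderiv_bound d
  have hM0 : 0 ≤ M := (abs_nonneg _).trans (hM 0)
  have hC0 : 0 ≤ C := by simpa using (abs_nonneg _).trans (hC 1 zero_le_one 0)
  set t : ℕ → ℝ := fun n => (1 / 2) ^ n with ht
  have htpos : ∀ n, 0 < t n := fun n => by positivity
  have htsucc : ∀ n, t (n + 1) = t n / 2 := fun n => by simp only [ht, pow_succ]; ring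
  set D : ℕ → Rd d → ℝ := fun n y => mollify (t (n + 1)) u y - mollify (t n) u y with hD
  have hmc : ∀ s, Continuous (mollify s u) := continuous_mollify hu
  have hDc : ∀ n, Continuous (D n) := fun n => (hmc _).sub (hmc _)
  have hDb : ∀ n x, |D n x| ≤ 2 * C * t n ^ 2 := fun n x => by
    have h1 := hC (t (n + 1)) (htpos _).le x
    have h2 := hC (t n) (htpos _).le x
    rw [abs_sub_comm] at h2
    have h3 := abs_sub_le (mollify (t (n + 1)) u x) (u x) (mollify (t n) u x)
    have h4 : C * t (n + 1) ^ 2 ≤ C * t n ^ 2 := by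
      rw [htsucc]
      nlinarith [mul_nonneg hC0 (sq_nonneg (t n))]
    exact h3.trans (by linarith)
  set F : ℕ → Rd d → ℝ := fun n x => dyadicAverage u (n + 1) x - dyadicAverage u n x with hF
  have hF0 : F 0 = mollify 1 (mollify 1 u) := by
    funext x
    simp [hF, dyadicAverage]
  have hFs : ∀ n, F (n + 1) = fun x => mollify (t (n + 1)) (D n) x + mollify (t n) (D n) x :=
    fun n => by
      funext x
      rw [hD, mollify_sub (hmc _) (hmc _), mollify_sub (hmc _) (hmc _), mollify_comm hu (t n)]
      simp only [hF, dyadicAverage, ht]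
      ring
  have hdiff : ∀ {w : Rd d → ℝ} {s : ℝ}, Continuous w → 0 < s → ContDiff ℝ 1 (mollify s w) :=
    fun hw hs => (contDiff_two_mollify hw hs.ne').of_le (by norm_num)
  have hfd : ∀ n x, fderiv ℝ (F (n + 1)) x =
      fderiv ℝ (mollify (t (n + 1)) (D n)) x + fderiv ℝ (mollify (t n) (D n)) x := fun n x => by
    rw [hFs]
    exact fderiv_add ((hdiff (hDc n) (htpos _)).differentiable (by norm_num) x)
      ((hdiff (hDc n) (htpos _)).differentiable (by norm_num) x)
  have hB1 := hB (mollify 1 u) M 1 (hmc 1) (fun x => abs_mollify_le hu fun y _ => hM y) one_pos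
  have hBn := fun n s hs => hB (D n) (2 * C * t n ^ 2) s (hDc n) (hDb n) hs
  have hBM : 0 ≤ B * M := by positivity
  have hBC : 0 ≤ B * C := by positivity
  refine contDiff_and_holderWith_of_dyadic (F := F) (A := B * M + 12 * (B * C)) ?_ ?_ ?_ ?_
  · rintro (_ | n)
    · rw [hF0]
      exact hdiff (hmc 1) one_pos
    · rw [hFs]
      exact (hdiff (hDc n) (htpos _)).add (hdiff (hDc n) (htpos _))
  · rintro (_ | n) x
    · rw [hF0]
      refine (hB1.1 x).trans ?_
      simp only [div_one, pow_zero, mul_one]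
      linarith
    · rw [hfd]
      refine (norm_add_le _ _).trans ((add_le_add ((hBn n _ (htpos _)).1 x)
        ((hBn n _ (htpos _)).1 x)).trans ?_)
      change _ ≤ (B * M + 12 * (B * C)) * t (n + 1)
      rw [htsucc]
      have hn := htpos n
      have h1 : B * (2 * C * t n ^ 2) / (t n / 2) + B * (2 * C * t n ^ 2) / t n =
          12 * (B * C) * (t n / 2) := by
        field_simp
        ring
      rw [h1]
      exact mul_le_mul_of_nonneg_right (by linarith) (by positivity)
  · rintro (_ | n) x y
    · rw [hF0]
      refine (hB1.2 x y).trans (mul_le_mul_of_nonneg_right ?_ (norm_nonneg _))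
      simp only [one_pow, div_one]
      linarith
    · rw [hfd, hfd, add_sub_add_comm]
      refine (norm_add_le _ _).trans ((add_le_add ((hBn n _ (htpos _)).2 x y)
        ((hBn n _ (htpos _)).2 x y)).trans ?_)
      rw [← add_mul]
      refine mul_le_mul_of_nonneg_right ?_ (norm_nonneg _)
      rw [htsucc]
      have hn := htpos n
      have h1 : B * (2 * C * t n ^ 2) / (t n / 2) ^ 2 + B * (2 * C * t n ^ 2) / t n ^ 2 =
          10 * (B * C) := by
        field_simp
        ring
      linarith
  · intro x
    have hsm : Summable fun n => F n x := by
      rw [← summable_nat_add_iff 1]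
      refine Summable.of_norm_bounded
        (g := fun n : ℕ => 4 * C * (1 / 2 : ℝ) ^ n) (summable_geometric_two.mul_left _) fun n => ?_
      have h1 : ∀ s, |mollify s (D n) x| ≤ 2 * C * t n ^ 2 := fun s =>
        abs_mollify_le (hDc n) fun y _ => hDb n y
      have h2 : t n ^ 2 ≤ t n := by
        have := pow_le_one₀ (n := n) (by norm_num : (0 : ℝ) ≤ 1 / 2) (by norm_num)
        nlinarith [htpos n]
      rw [hFs]
      refine (abs_add_le _ _).trans ((add_le_add (h1 _) (h1 _)).trans ?_)
      change _ ≤ 4 * C * t n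
      nlinarith
    rw [hsm.hasSum_iff_tendsto_nat]
    refine (tendsto_dyadicAverage hu hC x).congr fun n => ?_
    simp only [hF]
    rw [Finset.sum_range_sub (fun n => dyadicAverage u n x)]
    simp [dyadicAverage]

/-- **Theorem (existence and uniqueness for the double obstacle problem on the flat
torus).** -/
theorem dop_existence_uniqueness {d : ℕ}
    (φm φp : Rd d → ℝ) (τ : ℝ) (hτ : 0 < τ)
    (hmreg : ContDiff ℝ 2 φm) (hpreg : ContDiff ℝ 2 φp)
    (hmper : PeriodicRd φm) (hpper : PeriodicRd φp)
    (hmnc : ∃ x y : Rd d, φm x ≠ φm y) (hpnc : ∃ x y : Rd d, φp x ≠ φp y)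
    (hsep : ∀ x : Rd d, τ ≤ φp x - φm x) :
    -- existence of a C^{1,α} solution for every α ∈ (0,1):
    (∃ u : Rd d → ℝ, IsDOPSolution φm φp u ∧ ContDiff ℝ 1 u ∧
      ∀ a : NNReal, 0 < a → a < 1 → ∃ C : NNReal, HolderWith C a (fderiv ℝ u)) ∧
    -- uniqueness when max φ₋ ≥ min φ₊:
    (sInf (Set.range φp) ≤ sSup (Set.range φm) →
      ∀ u v : Rd d → ℝ, IsDOPSolution φm φp u → IsDOPSolution φm φp v → u = v) ∧
    -- when max φ₋ = min φ₊ the unique solution is the constant max φ₋: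
    (sInf (Set.range φp) = sSup (Set.range φm) →
      ∀ u : Rd d → ℝ, IsDOPSolution φm φp u → u = fun _ => sSup (Set.range φm)) := by
  have hle : ∀ x, φm x ≤ φp x := fun x => by linarith [hsep x]
  have huniq : sInf (Set.range φp) ≤ sSup (Set.range φm) →
      ∀ u v : Rd d → ℝ, IsDOPSolution φm φp u → IsDOPSolution φm φp v → u = v :=
    fun h u v hu hv => funext fun x =>
      le_antisymm (hu.le_of_sInf_le_sSup h hv x) (hv.le_of_sInf_le_sSup h hu x)
  refine ⟨?_, huniq, fun h u hu => huniq h.le u _ hu (isDOPSolution_const fun x => ⟨?_, ?_⟩)⟩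
  · obtain ⟨u, Λ, hu, hΛ⟩ := exists_isDOPSolution_bounded_laplacian hmreg hpreg hmper hpper hle
    obtain ⟨M, hM⟩ := hu.2.1.exists_bound hu.1
    refine ⟨u, hu, contDiff_and_holderWith_of_mollify_sub_le hu.1 hM
      (C := potentialMass d / 2 * Λ) fun t ht x => ?_⟩
    rw [mul_right_comm]
    exact abs_mollify_sub_self_le_of_bounded_laplacian hu.1 hΛ ht x
  · obtain ⟨M, hM⟩ := hmper.exists_bound hmreg.continuous
    refine le_csSup ⟨M, ?_⟩ (Set.mem_range_self x)
    rintro _ ⟨y, rfl⟩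
    exact (le_abs_self _).trans (hM y)
  · obtain ⟨M, hM⟩ := hpper.exists_bound hpreg.continuous
    rw [← h]
    refine csInf_le ⟨-M, ?_⟩ (Set.mem_range_self x)
    rintro _ ⟨y, rfl⟩
    exact (abs_le.1 (hM y)).1
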